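/- For every finite simple graph G and every integer s ≥ 1, reg(I(G)^s) ≤ 2s + min-match(G) − 1, where min-match(G) is the minimum cardinality of a maximal matching of G. -/

import Mathlib

open SimpleGraph

namespace Paper

/-- The complete graph on two vertices, `K₂`. -/
def k2 : SimpleGraph (Fin 2) := ⊤

/-- The 5-cycle `C₅`. -/
def cycle5 : SimpleGraph (ZMod 5) := SimpleGraph.fromRel (fun a b => b = a + 1)

/-- A graph is chordal if it has no induced cycle of length at least four. -/
def IsChordal {V : Type*} (G : SimpleGraph V) : Prop :=
  ∀ n : ℕ, 4 ≤ n → IsEmpty (SimpleGraph.cycleGraph n ↪g G)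

/-- A graph is co-chordal if its complement is chordal. -/
def IsCochordal {V : Type*} (G : SimpleGraph V) : Prop := IsChordal Gᶜ

/-- The co-chordal cover number: the minimum number of co-chordal subgraphs of `G`
needed to cover all edges of `G`. -/
noncomputable def cochord {V : Type*} (G : SimpleGraph V) : ℕ :=
  sInf { t | ∃ f : Fin t → SimpleGraph V,
    (∀ i, f i ≤ G ∧ IsCochordal (f i)) ∧ ∀ ⦃u v : V⦄, G.Adj u v → ∃ i, (f i).Adj u v }

/-- The closed neighborhood `N_G[w]`. -/
def closedNbhd {V : Type*} (G : SimpleGraph V) (w : V) : Set V :=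
  insert w (G.neighborSet w)

/-- The graph `G - N_G[w]`: the induced subgraph on the complement of the closed
neighborhood of `w`. -/
def delClosedNbhd {V : Type*} (G : SimpleGraph V) (w : V) :
    SimpleGraph ((closedNbhd G w)ᶜ : Set V) := G.induce _

/-- A maximal matching: a matching such that no edge of `G` is disjoint from all of
its edges. -/
def IsMaximalMatching {V : Type*} (G : SimpleGraph V) (M : G.Subgraph) : Prop :=
  M.IsMatching ∧ ∀ ⦃u v : V⦄, G.Adj u v → u ∈ M.support ∨ v ∈ M.support

/-- The minimum matching number: the minimum cardinality of a maximal matching. -/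
noncomputable def minMatch {V : Type*} (G : SimpleGraph V) : ℕ :=
  sInf { k | ∃ M : G.Subgraph, IsMaximalMatching G M ∧ M.edgeSet.ncard = k }

/-- The matching number of a graph: maximum cardinality of a matching. -/
noncomputable def matchNum {V : Type*} (G : SimpleGraph V) : ℕ :=
  sSup { k | ∃ M : G.Subgraph, M.IsMatching ∧ M.edgeSet.ncard = k }

/-- A graph all of whose connected components are isomorphic to `K₂` or `C₅`. -/
def IsK2C5Graph {V : Type*} (G : SimpleGraph V) : Prop :=
  ∀ c : G.ConnectedComponent,
    Nonempty (G.induce c.supp ≃g k2) ∨ Nonempty (G.induce c.supp ≃g cycle5)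

/-- A maximal `{K₂, C₅}`-subgraph of `G`: a subgraph whose components are all `K₂` or
`C₅` such that the induced subgraph of `G` on the vertices outside it has no edge. -/
def IsMaximalK2C5Subgraph {V : Type*} (G : SimpleGraph V) (H : G.Subgraph) : Prop :=
  IsK2C5Graph H.coe ∧ ∀ ⦃u v : V⦄, G.Adj u v → u ∈ H.verts ∨ v ∈ H.verts

/-- `min-match_{K₂,C₅}(G)`: the minimum matching number of a maximal
`{K₂, C₅}`-subgraph of `G` (with value `0` if `G` has no edge, via `sInf ∅ = 0`:
if `G` is edgeless the empty subgraph is a maximal `{K₂,C₅}`-subgraph). -/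
noncomputable def minMatchK2C5 {V : Type*} (G : SimpleGraph V) : ℕ :=
  sInf { k | ∃ H : G.Subgraph, IsMaximalK2C5Subgraph G H ∧ matchNum H.coe = k }

/-- An induced matching of `G`. -/
def IsInducedMatching {V : Type*} (G : SimpleGraph V) (M : G.Subgraph) : Prop :=
  M.IsMatching ∧ ∀ ⦃u v : V⦄, G.Adj u v → u ∈ M.support → v ∈ M.support → M.Adj u v

/-- The induced matching number of `G`. -/
noncomputable def indMatch {V : Type*} (G : SimpleGraph V) : ℕ :=
  sSup { k | ∃ M : G.Subgraph, IsInducedMatching G M ∧ M.edgeSet.ncard = k }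

/-- `ind-match_{K₂,C₅}(G)`: the maximum matching number of an induced subgraph of `G`
all of whose connected components are `K₂` or `C₅`. -/
noncomputable def indMatchK2C5 {V : Type*} (G : SimpleGraph V) : ℕ :=
  sSup { k | ∃ s : Set V, IsK2C5Graph (G.induce s) ∧ matchNum (G.induce s) = k }

/-- The edge ideal of a graph `G`, in the polynomial ring over `K` with variables
indexed by the vertices of `G`. -/
noncomputable def edgeIdeal (K : Type) [Field K] {V : Type} (G : SimpleGraph V) :
    Ideal (MvPolynomial V K) :=
  Ideal.span { m | ∃ u v : V, G.Adj u v ∧ m = MvPolynomial.X u * MvPolynomial.X v }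

/-- `HasResolutionDegreeBound K I r` says that the ideal `I` admits a graded free
resolution `⋯ → F₁ → F₀ → I → 0`, where `Fᵢ = ⊕_k S(-d i k)` is a graded free module
whose generators sit in degrees `d i k ≤ i + r`.  The maps are required to be graded
(degree-preserving) and the sequence exact.  By the standard characterization via the
minimal graded free resolution, the Castelnuovo–Mumford regularity of `I` is the least
`r` for which such a resolution exists. -/
def HasResolutionDegreeBound (K : Type) [Field K] {V : Type}
    (I : Ideal (MvPolynomial V K)) (r : ℕ) : Prop :=
  ∃ (m : ℕ → ℕ) (d : (i : ℕ) → Fin (m i) → ℕ)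
    (f : (i : ℕ) → ((Fin (m (i + 1)) → MvPolynomial V K) →ₗ[MvPolynomial V K]
        (Fin (m i) → MvPolynomial V K)))
    (ε : (Fin (m 0) → MvPolynomial V K) →ₗ[MvPolynomial V K] MvPolynomial V K),
    -- the augmentation map is graded: the image of the `k`-th basis vector is
    -- homogeneous of degree `d 0 k`
    (∀ k, MvPolynomial.IsHomogeneous (ε (Pi.single k 1)) (d 0 k)) ∧
    -- the differentials are graded maps of degree zero
    (∀ i k l, MvPolynomial.IsHomogeneous (f i (Pi.single k 1) l) (d (i + 1) k - d i l) ∧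
        (d (i + 1) k < d i l → f i (Pi.single k 1) l = 0)) ∧
    -- exactness: `F₀` surjects onto `I`, and the complex is exact
    LinearMap.range ε = I ∧
    LinearMap.range (f 0) = LinearMap.ker ε ∧
    (∀ i, LinearMap.range (f (i + 1)) = LinearMap.ker (f i)) ∧
    -- the degree bound on the twists
    (∀ i k, d i k ≤ i + r)

/-- The Castelnuovo–Mumford regularity of an ideal in a polynomial ring:
the least `r` such that `I` has a graded free resolution whose `i`-th free module is
generated in degrees `≤ i + r`. -/
noncomputable def reg (K : Type) [Field K] {V : Type} (I : Ideal (MvPolynomial V K)) : ℕ :=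
  sInf { r | HasResolutionDegreeBound K I r }

section GradedModules

variable {K : Type} [Field K] {V : Type}

/-- A module over the polynomial ring with a family of additive subgroups of homogeneous
elements, compatible with multiplication by homogeneous polynomials. -/
structure GrMod (K : Type) [Field K] (V : Type) where
  carrier : Type
  [addCommGroup : AddCommGroup carrier]
  [module : Module (MvPolynomial V K) carrier]
  gr : ℕ → AddSubgroup carrier
  smul_mem : ∀ {p : MvPolynomial V K} {j e : ℕ} {x : carrier},
    p.IsHomogeneous j → x ∈ gr e → p • x ∈ gr (j + e)

instance : CoeSort (GrMod K V) Type := ⟨GrMod.carrier⟩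

attribute [instance] GrMod.addCommGroup GrMod.module

/-- A short exact sequence of graded modules with maps of degree zero. -/
structure IsSES (A B C : GrMod K V) (f : A →ₗ[MvPolynomial V K] B)
    (g : B →ₗ[MvPolynomial V K] C) : Prop where
  inj : Function.Injective f
  exact : ∀ b, g b = 0 ↔ ∃ a, f a = b
  gr_iff : ∀ a e, f a ∈ B.gr e ↔ a ∈ A.gr e
  map_gr : ∀ b e, b ∈ B.gr e → g b ∈ C.gr e
  surj : Function.Surjective g
  surj_gr : ∀ c e, c ∈ C.gr e → ∃ b ∈ B.gr e, g b = c

lemma weight_one_eq_degree (c : V →₀ ℕ) : Finsupp.weight (1 : V → ℕ) c = c.degree := by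
  rw [Finsupp.degree_eq_weight_one]
  rfl

/-- The polynomial `p` is homogeneous of degree `e` in the free module `S(-a)`. -/
def IsTwistedHomogeneous (a e : ℕ) (p : MvPolynomial V K) : Prop :=
  ∀ c ∈ p.support, c.degree + a = e

namespace IsTwistedHomogeneous

lemma zero (a e : ℕ) : IsTwistedHomogeneous a e (0 : MvPolynomial V K) := by
  simp [IsTwistedHomogeneous]

lemma add {a e : ℕ} {p q : MvPolynomial V K} (hp : IsTwistedHomogeneous a e p)
    (hq : IsTwistedHomogeneous a e q) : IsTwistedHomogeneous a e (p + q) := by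
  classical
  intro c hc
  rcases Finset.mem_union.1 (MvPolynomial.support_add hc) with h | h
  · exact hp c h
  · exact hq c h

lemma neg {a e : ℕ} {p : MvPolynomial V K} (hp : IsTwistedHomogeneous a e p) :
    IsTwistedHomogeneous a e (-p) := by
  intro c hc
  rw [MvPolynomial.support_neg] at hc
  exact hp c hc

lemma iff_isHomogeneous {a e : ℕ} {p : MvPolynomial V K} :
    IsTwistedHomogeneous a e p ↔ p = 0 ∨ a ≤ e ∧ p.IsHomogeneous (e - a) := by
  constructor
  · intro h
    by_cases hp : p = 0
    · exact Or.inl hp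
    right
    obtain ⟨c, hc⟩ := Finset.nonempty_iff_ne_empty.2
      (fun h => hp (MvPolynomial.support_eq_empty.1 h))
    have h1 := h c hc
    refine ⟨by omega, fun c' hc' => ?_⟩
    have h2 := h c' (MvPolynomial.mem_support_iff.2 hc')
    rw [weight_one_eq_degree]
    omega
  · rintro (rfl | ⟨h1, h2⟩)
    · exact zero a e
    · intro c hc
      have := h2 (MvPolynomial.mem_support_iff.1 hc)
      rw [weight_one_eq_degree] at this
      omega

lemma zero_left_iff {e : ℕ} {p : MvPolynomial V K} :
    IsTwistedHomogeneous 0 e p ↔ p.IsHomogeneous e := by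
  rw [iff_isHomogeneous]
  constructor
  · rintro (rfl | h)
    · exact MvPolynomial.isHomogeneous_zero _ _ _
    · exact h.2
  · exact fun h => Or.inr ⟨Nat.zero_le _, h⟩

lemma mul {a e j : ℕ} {p q : MvPolynomial V K} (hp : p.IsHomogeneous j)
    (hq : IsTwistedHomogeneous a e q) : IsTwistedHomogeneous a (j + e) (p * q) := by
  rcases iff_isHomogeneous.1 hq with rfl | ⟨h1, h2⟩
  · simpa using zero a _
  · refine iff_isHomogeneous.2 (Or.inr ⟨by omega, ?_⟩)
    rw [Nat.add_sub_assoc h1]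
    exact hp.mul h2

end IsTwistedHomogeneous

/-- The graded free module `⊕ S(-d i)`. -/
noncomputable abbrev freeMod (K : Type) [Field K] {V ι : Type} (d : ι → ℕ) : GrMod K V where
  carrier := ι → MvPolynomial V K
  gr e :=
    { carrier := {v | ∀ i, IsTwistedHomogeneous (d i) e (v i)}
      zero_mem' := fun _ => .zero _ _
      add_mem' := fun hv hw i => (hv i).add (hw i)
      neg_mem' := fun hv i => (hv i).neg }
  smul_mem := fun hp hx i => .mul hp (hx i)

/-- A homogeneous ideal, twisted by `-a`, as a graded module. -/
noncomputable abbrev idealMod (I : Ideal (MvPolynomial V K)) (a : ℕ) : GrMod K V where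
  carrier := I
  gr e :=
    { carrier := {v | IsTwistedHomogeneous a e (v : MvPolynomial V K)}
      zero_mem' := .zero _ _
      add_mem' := fun hv hw => hv.add hw
      neg_mem' := fun hv => hv.neg }
  smul_mem := fun hp hx => .mul hp hx

/-- The direct sum of two graded modules. -/
noncomputable abbrev prodMod (A B : GrMod K V) : GrMod K V where
  carrier := A × B
  gr e := (A.gr e).prod (B.gr e)
  smul_mem := fun hp hx => ⟨A.smul_mem hp hx.1, B.smul_mem hp hx.2⟩

/-- The kernel of a homomorphism, graded as a submodule of its source. -/
noncomputable abbrev kerMod (B : GrMod K V) {C : GrMod K V} (g : B →ₗ[MvPolynomial V K] C) :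
    GrMod K V where
  carrier := LinearMap.ker g
  gr e := (B.gr e).comap (LinearMap.ker g).subtype.toAddMonoidHom
  smul_mem := fun hp hx => B.smul_mem hp hx

/-- `F` is a graded free module of finite rank with generators in degrees at most `r`. -/
def IsFree (F : GrMod K V) (r : ℕ) : Prop :=
  ∃ (ι : Type) (_ : Fintype ι) (d : ι → ℕ)
    (φ : F ≃ₗ[MvPolynomial V K] (ι → MvPolynomial V K)), (∀ i, d i ≤ r) ∧
      ∀ x e, (∀ i, IsTwistedHomogeneous (d i) e (φ x i)) ↔ x ∈ F.gr e

/-- Homomorphisms of degree zero. -/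
def IsGr {A B : GrMod K V} (f : A →ₗ[MvPolynomial V K] B) : Prop :=
  ∀ x e, x ∈ A.gr e → f x ∈ B.gr e

/-- Homomorphisms of degree zero that are surjective, also in every degree. -/
def IsGrSurj {A B : GrMod K V} (f : A →ₗ[MvPolynomial V K] B) : Prop :=
  IsGr f ∧ Function.Surjective f ∧ ∀ c e, c ∈ B.gr e → ∃ b ∈ A.gr e, f b = c

/-- `RegLE n N r`: the first `n` steps of every graded free resolution of `N` by modules
generated in degrees `≤ r, r + 1, …` exist and can be continued. -/
def RegLE : ℕ → GrMod K V → ℕ → Prop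
  | 0, _, _ => True
  | n + 1, N, r =>
    (∃ (F : GrMod K V) (g : F →ₗ[MvPolynomial V K] N), IsFree F r ∧ IsGrSurj g) ∧
    ∀ (F L : GrMod K V) (f : L →ₗ[MvPolynomial V K] F) (g : F →ₗ[MvPolynomial V K] N),
      IsFree F r → IsSES L F N f g → RegLE n L (r + 1)

lemma IsSES.isGrSurj {A B C : GrMod K V} {f : A →ₗ[MvPolynomial V K] B}
    {g : B →ₗ[MvPolynomial V K] C} (h : IsSES A B C f g) : IsGrSurj g :=
  ⟨h.map_gr, h.surj, h.surj_gr⟩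

lemma IsGrSurj.comp {A B C : GrMod K V} {f : A →ₗ[MvPolynomial V K] B}
    {g : B →ₗ[MvPolynomial V K] C} (hg : IsGrSurj g) (hf : IsGrSurj f) :
    IsGrSurj (g ∘ₗ f) := by
  refine ⟨fun x e hx => hg.1 _ _ (hf.1 _ _ hx), hg.2.1.comp hf.2.1, fun c e hc => ?_⟩
  obtain ⟨b, hb, rfl⟩ := hg.2.2 c e hc
  obtain ⟨a, ha, rfl⟩ := hf.2.2 b e hb
  exact ⟨a, ha, rfl⟩

/-- The kernel sequence of a graded surjection. -/
lemma IsGrSurj.isSES_ker {B C : GrMod K V} {g : B →ₗ[MvPolynomial V K] C}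
    (hg : IsGrSurj g) : IsSES (kerMod B g) B C (LinearMap.ker g).subtype g where
  inj := Subtype.val_injective
  exact b := ⟨fun h => ⟨⟨b, h⟩, rfl⟩, by rintro ⟨a, rfl⟩; exact a.2⟩
  gr_iff _ _ := Iff.rfl
  map_gr := hg.1
  surj := hg.2.1
  surj_gr := hg.2.2

lemma IsFree.mono {F : GrMod K V} {r s : ℕ} (h : IsFree F r) (hrs : r ≤ s) : IsFree F s := by
  obtain ⟨ι, i, d, φ, h1, h2⟩ := h
  exact ⟨ι, i, d, φ, fun k => (h1 k).trans hrs, h2⟩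

lemma isFree_freeMod {ι : Type} [Fintype ι] {d : ι → ℕ} {r : ℕ} (h : ∀ i, d i ≤ r) :
    IsFree (freeMod K d : GrMod K V) r :=
  ⟨ι, inferInstance, d, LinearEquiv.refl _ _, h, fun _ _ => Iff.rfl⟩

lemma IsFree.prod {F G : GrMod K V} {r : ℕ} (hF : IsFree F r) (hG : IsFree G r) :
    IsFree (prodMod F G) r := by
  obtain ⟨ι, i, d, φ, h1, h2⟩ := hF
  obtain ⟨κ, k, d', ψ, h3, h4⟩ := hG
  refine ⟨ι ⊕ κ, inferInstance, Sum.elim d d',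
    (φ.prodCongr ψ).trans (LinearEquiv.sumArrowLequivProdArrow ι κ (MvPolynomial V K)
      (MvPolynomial V K)).symm, ?_, ?_⟩
  · rintro (i | i)
    · exact h1 i
    · exact h3 i
  · rintro ⟨x, y⟩ e
    refine Iff.trans ?_ (and_congr (h2 x e) (h4 y e))
    exact Sum.forall

lemma IsFree.lift {F B C : GrMod K V} {r : ℕ} (hF : IsFree F r)
    {g : B →ₗ[MvPolynomial V K] C} (hg : IsGrSurj g) {h : F →ₗ[MvPolynomial V K] C}
    (hh : IsGr h) : ∃ h' : F →ₗ[MvPolynomial V K] B, IsGr h' ∧ ∀ x, g (h' x) = h x := by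
  classical
  obtain ⟨ι, _, d, φ, h1, h2⟩ := hF
  have key : ∀ k, ∃ b ∈ B.gr (d k), g b = h (φ.symm (Pi.single k 1)) := by
    intro k
    apply hg.2.2
    apply hh
    rw [← h2, LinearEquiv.apply_symm_apply]
    intro l
    by_cases hl : l = k
    · subst hl
      rw [Pi.single_eq_same, IsTwistedHomogeneous.iff_isHomogeneous]
      right
      simpa using MvPolynomial.isHomogeneous_one V K
    · rw [Pi.single_eq_of_ne hl]
      exact .zero _ _
  choose b hb1 hb2 using key
  refine ⟨(Fintype.linearCombination (MvPolynomial V K) b) ∘ₗ φ.toLinearMap, ?_, ?_⟩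
  · intro x e hx
    rw [← h2] at hx
    simp only [LinearMap.comp_apply, Fintype.linearCombination_apply]
    refine AddSubgroup.sum_mem _ fun k _ => ?_
    rcases IsTwistedHomogeneous.iff_isHomogeneous.1 (hx k) with h0 | ⟨h3, h4⟩
    · have h0' : (φ.toLinearMap x) k = 0 := h0
      rw [h0', zero_smul]
      exact AddSubgroup.zero_mem _
    · have := B.smul_mem h4 (hb1 k)
      rwa [Nat.sub_add_cancel h3] at this
  · intro x
    obtain ⟨v, rfl⟩ := φ.symm.surjective x
    have : g ∘ₗ (Fintype.linearCombination (MvPolynomial V K) b) = h ∘ₗ φ.symm.toLinearMap := by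
      refine LinearMap.pi_ext' fun k => LinearMap.ext_ring ?_
      simpa [Fintype.linearCombination_apply_single] using hb2 k
    simpa using LinearMap.congr_fun this v

lemma RegLE.exists_cover {n : ℕ} {N : GrMod K V} {r : ℕ} (h : RegLE (n + 1) N r) :
    ∃ (F : GrMod K V) (g : F →ₗ[MvPolynomial V K] N), IsFree F r ∧ IsGrSurj g := h.1

lemma RegLE.ker {n : ℕ} {N : GrMod K V} {r : ℕ} (h : RegLE (n + 1) N r) {F : GrMod K V}
    {g : F →ₗ[MvPolynomial V K] N} (hF : IsFree F r) (hg : IsGrSurj g) :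
    RegLE n (kerMod F g) (r + 1) := h.2 _ _ _ _ hF hg.isSES_ker

lemma RegLE.summand {n : ℕ} : ∀ {A G : GrMod K V} {r : ℕ}, RegLE n (prodMod A G) r →
    IsFree G r → RegLE n A r := by
  cases n with
  | zero => intros; trivial
  | succ n =>
    intro A G r h hG
    constructor
    · obtain ⟨F, g, hF, hg⟩ := h.exists_cover
      refine ⟨F, LinearMap.fst (MvPolynomial V K) A G ∘ₗ g, hF, ?_⟩
      refine IsGrSurj.comp (B := prodMod A G) ⟨fun x e hx => hx.1, Prod.fst_surjective, ?_⟩ hg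
      exact fun c e hc => ⟨(c, 0), ⟨hc, AddSubgroup.zero_mem _⟩, rfl⟩
    · intro F L f g hF hs
      refine h.2 (prodMod F G) L (LinearMap.inl (MvPolynomial V K) F G ∘ₗ f)
        (g.prodMap LinearMap.id) (hF.prod hG) ?_
      constructor
      · exact fun x y hxy => hs.inj (congrArg Prod.fst hxy)
      · rintro ⟨x, y⟩
        constructor
        · intro hxy
          have h1 : g x = 0 := congrArg Prod.fst hxy
          have h2 : y = 0 := congrArg Prod.snd hxy
          obtain ⟨a, rfl⟩ := (hs.exact x).1 h1
          exact ⟨a, by rw [h2]; rfl⟩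
        · rintro ⟨a, ha⟩
          have h1 : f a = x := congrArg Prod.fst ha
          have h2 : 0 = y := congrArg Prod.snd ha
          exact Prod.ext ((hs.exact x).2 ⟨a, h1⟩) h2.symm
      · exact fun a e => ⟨fun h => (hs.gr_iff a e).1 h.1,
          fun h => ⟨(hs.gr_iff a e).2 h, AddSubgroup.zero_mem _⟩⟩
      · exact fun b e hb => ⟨hs.map_gr _ _ hb.1, hb.2⟩
      · rintro ⟨x, y⟩
        obtain ⟨b, rfl⟩ := hs.surj x
        exact ⟨(b, y), rfl⟩
      · rintro ⟨x, y⟩ e hxy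
        obtain ⟨b, hb, rfl⟩ := hs.surj_gr x e hxy.1
        exact ⟨(b, y), ⟨hb, hxy.2⟩, rfl⟩

/-- Two maps with a common target, the first a graded surjection, are jointly surjective. -/
lemma IsGrSurj.coprod {A B C : GrMod K V} {f : A →ₗ[MvPolynomial V K] C}
    {g : B →ₗ[MvPolynomial V K] C} (hf : IsGr f) (hg : IsGrSurj g) :
    IsGrSurj (A := prodMod A B) (f.coprod g) := by
  refine ⟨fun x e hx => AddSubgroup.add_mem _ (hf _ _ hx.1) (hg.1 _ _ hx.2), fun c => ?_,
    fun c e hc => ?_⟩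
  · obtain ⟨b, rfl⟩ := hg.2.1 c
    exact ⟨(0, b), by simp⟩
  · obtain ⟨b, hb, rfl⟩ := hg.2.2 c e hc
    exact ⟨(0, b), ⟨AddSubgroup.zero_mem _, hb⟩, by simp⟩

/-- Given an extension of `C` by `A` and a cover of `C` lifted to `B`, the sequence
`0 → ker → A ⊕ G → B → 0`. -/
lemma IsSES.coprod_isSES {A B C G : GrMod K V} {f : A →ₗ[MvPolynomial V K] B}
    {g : B →ₗ[MvPolynomial V K] C} (h : IsSES A B C f g) {q : G →ₗ[MvPolynomial V K] B}
    (hq : IsGr q) (hgq : IsGrSurj (g ∘ₗ q)) :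
    IsGrSurj (A := prodMod A G) (f.coprod q) := by
  refine ⟨fun x e hx => AddSubgroup.add_mem _ ((h.gr_iff _ _).2 hx.1) (hq _ _ hx.2),
    fun b => ?_, fun b e hb => ?_⟩
  · obtain ⟨y, hy⟩ := hgq.2.1 (g b)
    have : g (b - q y) = 0 := by
      rw [map_sub, ← hy]; simp
    obtain ⟨a, ha⟩ := (h.exact _).1 this
    exact ⟨(a, y), by simp [ha]⟩
  · obtain ⟨y, hye, hy⟩ := hgq.2.2 (g b) e (h.map_gr _ _ hb)
    have : g (b - q y) = 0 := by
      rw [map_sub, ← hy]; simp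
    obtain ⟨a, ha⟩ := (h.exact _).1 this
    refine ⟨(a, y), ⟨(h.gr_iff _ _).1 ?_, hye⟩, by simp [ha]⟩
    rw [ha]
    exact AddSubgroup.sub_mem _ hb (hq _ _ hye)

/-- The kernel of `A ⊕ G → B` is isomorphic to the kernel of `G → C`. -/
lemma IsSES.ker_isSES {A B C G : GrMod K V} {f : A →ₗ[MvPolynomial V K] B}
    {g : B →ₗ[MvPolynomial V K] C} (h : IsSES A B C f g) {q : G →ₗ[MvPolynomial V K] B}
    (hq : IsGr q) (hgq : IsGrSurj (g ∘ₗ q)) :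
    ∃ ι : kerMod G (g ∘ₗ q) →ₗ[MvPolynomial V K] prodMod A G,
      IsSES (kerMod G (g ∘ₗ q)) (prodMod A G) B ι (f.coprod q) := by
  have key : ∀ x : kerMod G (g ∘ₗ q), ∃ a, f a = q x.1 := fun x => (h.exact _).1 x.2
  choose s hs using key
  let σ : kerMod G (g ∘ₗ q) →ₗ[MvPolynomial V K] A :=
    { toFun := s
      map_add' := fun x y => h.inj (by rw [map_add, hs, hs, hs]; simp)
      map_smul' := fun c x => h.inj (by rw [map_smul, hs, hs]; simp) }
  have hc := h.coprod_isSES hq hgq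
  refine ⟨(-σ).prod (LinearMap.ker (g ∘ₗ q)).subtype, ?_, ?_, ?_, hc.1, hc.2.1, hc.2.2⟩
  · exact fun x y hxy => Subtype.ext (congrArg Prod.snd hxy)
  · rintro ⟨a, y⟩
    constructor
    · intro hay
      have h1 : f a + q y = 0 := by simpa using hay
      have h2 : g (q y) = 0 := by
        have h3 := congrArg g h1
        rw [map_add, (h.exact (f a)).2 ⟨a, rfl⟩] at h3
        simpa using h3
      refine ⟨⟨y, h2⟩, Prod.ext (h.inj ?_) rfl⟩
      have h4 : f (-(s ⟨y, h2⟩)) = f a := by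
        rw [map_neg, hs]
        exact (eq_neg_of_add_eq_zero_left h1).symm
      exact h4
    · rintro ⟨x, hx⟩
      have h1 : -(s x) = a := congrArg Prod.fst hx
      have h2 : (x : G) = y := congrArg Prod.snd hx
      have : f a + q y = 0 := by
        rw [← h1, ← h2, map_neg, hs]; simp
      simpa using this
  · intro x e
    refine ⟨fun hx => hx.2, fun hx => ⟨?_, hx⟩⟩
    have : s x ∈ A.gr e := by
      rw [← h.gr_iff, hs]
      exact hq _ _ hx
    exact AddSubgroup.neg_mem _ this

/-- For an extension `B` of `C` by `A` covered by `F`, the kernel of `F → C` is an extension of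
`A` by the kernel of `F → B`. -/
lemma IsSES.ker_comp_isSES {A B C F L : GrMod K V} {f : A →ₗ[MvPolynomial V K] B}
    {g : B →ₗ[MvPolynomial V K] C} (h : IsSES A B C f g) {i : L →ₗ[MvPolynomial V K] F}
    {p : F →ₗ[MvPolynomial V K] B} (hs : IsSES L F B i p) :
    ∃ (j : L →ₗ[MvPolynomial V K] kerMod F (g ∘ₗ p))
      (σ : kerMod F (g ∘ₗ p) →ₗ[MvPolynomial V K] A),
      IsSES L (kerMod F (g ∘ₗ p)) A j σ := by
  have key : ∀ x : kerMod F (g ∘ₗ p), ∃ a, f a = p x.1 := fun x => (h.exact _).1 x.2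
  choose s hs' using key
  let σ : kerMod F (g ∘ₗ p) →ₗ[MvPolynomial V K] A :=
    { toFun := s
      map_add' := fun x y => h.inj (by rw [map_add, hs', hs', hs']; simp)
      map_smul' := fun c x => h.inj (by rw [map_smul, hs', hs']; simp) }
  let j : L →ₗ[MvPolynomial V K] kerMod F (g ∘ₗ p) :=
    i.codRestrict _ (fun x => by
      have : p (i x) = 0 := (hs.exact _).2 ⟨x, rfl⟩
      simp [this])
  refine ⟨j, σ, ?_⟩
  constructor
  · exact fun x y hxy => hs.inj (congrArg Subtype.val hxy)
  · intro b
    constructor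
    · intro hb
      have : p b.1 = 0 := by
        have h1 : s b = 0 := hb
        rw [← hs' b, h1, map_zero]
      obtain ⟨a, ha⟩ := (hs.exact _).1 this
      exact ⟨a, Subtype.ext ha⟩
    · rintro ⟨a, rfl⟩
      apply h.inj
      have h1 : f (s (j a)) = 0 := by
        rw [hs']
        exact (hs.exact _).2 ⟨a, rfl⟩
      rw [map_zero]
      exact h1
  · exact fun a e => hs.gr_iff a e
  · intro b e hb
    rw [← h.gr_iff]
    have : f (s b) ∈ B.gr e := by
      rw [hs']
      exact hs.map_gr _ _ hb
    exact this
  · intro a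
    obtain ⟨x, hx⟩ := hs.surj (f a)
    have h0 : (g ∘ₗ p) x = 0 := by
      rw [LinearMap.comp_apply, hx]
      exact (h.exact _).2 ⟨a, rfl⟩
    refine ⟨⟨x, h0⟩, h.inj ?_⟩
    exact (hs' ⟨x, h0⟩).trans hx
  · intro a e ha
    obtain ⟨x, hxe, hx⟩ := hs.surj_gr (f a) e ((h.gr_iff _ _).2 ha)
    have h0 : (g ∘ₗ p) x = 0 := by
      rw [LinearMap.comp_apply, hx]
      exact (h.exact _).2 ⟨a, rfl⟩
    refine ⟨⟨x, h0⟩, hxe, h.inj ?_⟩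
    exact (hs' ⟨x, h0⟩).trans hx

lemma RegLE.ext_aux (n : ℕ) :
    (∀ {A B C : GrMod K V} {f : A →ₗ[MvPolynomial V K] B} {g : B →ₗ[MvPolynomial V K] C}
      {r : ℕ}, IsSES A B C f g → RegLE n A r → RegLE n C r → RegLE n B r) ∧
    (∀ {A B C : GrMod K V} {f : A →ₗ[MvPolynomial V K] B} {g : B →ₗ[MvPolynomial V K] C}
      {r : ℕ}, IsSES A B C f g → RegLE n B (r + 1) → RegLE (n + 1) C r →
        RegLE n A (r + 1)) := by
  have third : ∀ n : ℕ, (∀ {A B C : GrMod K V} {f : A →ₗ[MvPolynomial V K] B}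
      {g : B →ₗ[MvPolynomial V K] C}
      {r : ℕ}, IsSES A B C f g → RegLE n A r → RegLE n C r → RegLE n B r) →
    (∀ {A B C : GrMod K V} {f : A →ₗ[MvPolynomial V K] B} {g : B →ₗ[MvPolynomial V K] C}
      {r : ℕ}, IsSES A B C f g → RegLE n B (r + 1) → RegLE (n + 1) C r →
        RegLE n A (r + 1)) := by
    intro n hext A B C f g r h hB hC
    obtain ⟨G, q, hG, hq⟩ := hC.exists_cover
    obtain ⟨q', hq', hqq⟩ := hG.lift h.isGrSurj hq.1
    have hqq : g ∘ₗ q' = q := LinearMap.ext hqq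
    subst hqq
    obtain ⟨ι, hι⟩ := h.ker_isSES hq' hq
    exact (hext hι (hC.ker hG hq) hB).summand (hG.mono (Nat.le_succ r))
  induction n with
  | zero => exact ⟨fun _ _ _ => trivial, fun _ _ _ => trivial⟩
  | succ n ih =>
    suffices hext : _ from ⟨hext, third (n + 1) hext⟩
    intro A B C f g r h hA hC
    constructor
    · obtain ⟨F, p, hF, hp⟩ := hA.exists_cover
      obtain ⟨G, q, hG, hq⟩ := hC.exists_cover
      obtain ⟨q', hq', hqq⟩ := hG.lift h.isGrSurj hq.1
      have hqq : g ∘ₗ q' = q := LinearMap.ext hqq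
      subst hqq
      refine ⟨prodMod F G, f.coprod q' ∘ₗ p.prodMap LinearMap.id, hF.prod hG, ?_⟩
      refine IsGrSurj.comp (B := prodMod A G) (h.coprod_isSES hq' hq) ⟨?_, ?_, ?_⟩
      · exact fun x e hx => ⟨hp.1 _ _ hx.1, hx.2⟩
      · rintro ⟨x, y⟩
        obtain ⟨b, rfl⟩ := hp.2.1 x
        exact ⟨(b, y), rfl⟩
      · rintro ⟨x, y⟩ e hxy
        obtain ⟨b, hb, rfl⟩ := hp.2.2 x e hxy.1
        exact ⟨(b, y), ⟨hb, hxy.2⟩, rfl⟩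
    · intro F L i p hF hs
      have hgp : IsGrSurj (g ∘ₗ p) := h.isGrSurj.comp hs.isGrSurj
      have hK := hC.ker hF hgp
      obtain ⟨j, σ, hses⟩ := h.ker_comp_isSES hs
      exact ih.2 hses hK hA

lemma RegLE.ext {n : ℕ} {A B C : GrMod K V} {f : A →ₗ[MvPolynomial V K] B}
    {g : B →ₗ[MvPolynomial V K] C} {r : ℕ} (h : IsSES A B C f g) (hA : RegLE n A r)
    (hC : RegLE n C r) : RegLE n B r := (RegLE.ext_aux n).1 h hA hC

lemma RegLE.sub {n : ℕ} {A B C : GrMod K V} {f : A →ₗ[MvPolynomial V K] B}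
    {g : B →ₗ[MvPolynomial V K] C} {r : ℕ} (h : IsSES A B C f g) (hB : RegLE n B (r + 1))
    (hC : RegLE (n + 1) C r) : RegLE n A (r + 1) := (RegLE.ext_aux n).2 h hB hC

lemma isSES_prod (A B : GrMod K V) : IsSES A (prodMod A B) B
    (LinearMap.inl (MvPolynomial V K) A B) (LinearMap.snd (MvPolynomial V K) A B) where
  inj := LinearMap.inl_injective
  exact := by
    rintro ⟨x, y⟩
    constructor
    · rintro (rfl : y = 0)
      exact ⟨x, rfl⟩
    · rintro ⟨a, ha⟩
      exact (congrArg Prod.snd ha).symm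
  gr_iff a e := ⟨fun h => h.1, fun h => ⟨h, AddSubgroup.zero_mem _⟩⟩
  map_gr b e h := h.2
  surj := Prod.snd_surjective
  surj_gr c e h := ⟨(0, c), ⟨AddSubgroup.zero_mem _, h⟩, rfl⟩

lemma RegLE.prod {n : ℕ} {A B : GrMod K V} {r : ℕ} (hA : RegLE n A r) (hB : RegLE n B r) :
    RegLE n (prodMod A B) r := RegLE.ext (isSES_prod A B) hA hB

/-- Graded isomorphisms preserve the regularity bound. -/
lemma RegLE.of_equiv {n : ℕ} {A B : GrMod K V} {r : ℕ} (φ : A ≃ₗ[MvPolynomial V K] B)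
    (hφ : ∀ x e, φ x ∈ B.gr e ↔ x ∈ A.gr e) (hA : RegLE n A r) : RegLE n B r := by
  cases n with
  | zero => trivial
  | succ n =>
    constructor
    · obtain ⟨F, g, hF, hg⟩ := hA.exists_cover
      refine ⟨F, φ.toLinearMap ∘ₗ g, hF, IsGrSurj.comp ⟨fun x e hx => (hφ x e).2 hx,
        φ.surjective, fun c e hc => ⟨φ.symm c, ?_, φ.apply_symm_apply c⟩⟩ hg⟩
      rwa [← hφ, LinearEquiv.apply_symm_apply]
    · intro F L f g hF hs
      refine hA.2 F L f (φ.symm.toLinearMap ∘ₗ g) hF ⟨hs.inj, fun b => ?_, hs.gr_iff, ?_, ?_, ?_⟩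
      · rw [← hs.exact]
        exact φ.symm.map_eq_zero_iff
      · intro b e hb
        rw [← hφ]
        simpa using hs.map_gr b e hb
      · exact φ.symm.surjective.comp hs.surj
      · intro c e hc
        obtain ⟨b, hb, h⟩ := hs.surj_gr (φ c) e ((hφ c e).2 hc)
        exact ⟨b, hb, by simp [h]⟩

lemma RegLE.of_isFree (n : ℕ) : ∀ {F : GrMod K V} {r : ℕ}, IsFree F r → RegLE n F r := by
  induction n with
  | zero => intros; trivial
  | succ n ih =>
    intro F r hF
    constructor
    · exact ⟨F, LinearMap.id, hF, fun _ _ h => h, Function.surjective_id,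
        fun c e hc => ⟨c, hc, rfl⟩⟩
    · intro G L f g hG hs
      obtain ⟨s, hs1, hs2⟩ := hF.lift hs.isGrSurj (h := LinearMap.id) (fun _ _ h => h)
      have hgs : g ∘ₗ s = LinearMap.id := LinearMap.ext hs2
      have hid : IsGrSurj (g ∘ₗ s) := by
        rw [hgs]
        exact ⟨fun _ _ h => h, Function.surjective_id, fun c e hc => ⟨c, hc, rfl⟩⟩
      have hc := hs.coprod_isSES hs1 hid
      have hinj : Function.Injective (f.coprod s) := by
        rw [← LinearMap.ker_eq_bot, LinearMap.ker_eq_bot']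
        rintro ⟨a, y⟩ hay
        have h1 : f a + s y = 0 := by simpa using hay
        have h2 : y = 0 := by
          have h3 := congrArg g h1
          rw [map_add, (hs.exact (f a)).2 ⟨a, rfl⟩, hs2] at h3
          simpa using h3
        subst h2
        rw [map_zero, add_zero] at h1
        have h4 : a = 0 := hs.inj (by rw [h1, map_zero])
        rw [h4]
        rfl
      let φ : prodMod L F ≃ₗ[MvPolynomial V K] G := LinearEquiv.ofBijective _ ⟨hinj, hc.2.1⟩
      refine RegLE.summand (G := F) ?_ (hF.mono (Nat.le_succ r))
      refine RegLE.of_equiv φ.symm (fun x e => ?_) (ih (hG.mono (Nat.le_succ r)))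
      constructor
      · intro h
        have := hc.1 _ _ h
        rwa [show f.coprod s (φ.symm x) = x from φ.apply_symm_apply x] at this
      · intro h
        obtain ⟨b, hb, hb'⟩ := hc.2.2 x e h
        rwa [show φ.symm x = b from hinj (by
          rw [hb']
          exact φ.apply_symm_apply x)]

/-- If `G → N` is a graded surjection, the kernel of `F ⊕ G → N` is an extension of `F` by
`ker (G → N)`. -/
lemma isSES_ker_coprod {F G N : GrMod K V} {p : F →ₗ[MvPolynomial V K] N}
    {q : G →ₗ[MvPolynomial V K] N} (hp : IsGr p) (hq : IsGrSurj q) :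
    ∃ (i : kerMod G q →ₗ[MvPolynomial V K] kerMod (prodMod F G) (p.coprod q))
      (j : kerMod (prodMod F G) (p.coprod q) →ₗ[MvPolynomial V K] F),
      IsSES (kerMod G q) (kerMod (prodMod F G) (p.coprod q)) F i j := by
  refine ⟨(LinearMap.inr (MvPolynomial V K) F G ∘ₗ (LinearMap.ker q).subtype).codRestrict _
    (fun x => by simp), LinearMap.fst (MvPolynomial V K) F G ∘ₗ
      (LinearMap.ker (p.coprod q)).subtype, ?_, ?_, ?_, ?_, ?_, ?_⟩
  · intro x y hxy
    exact Subtype.ext (congrArg (fun z => z.1.2) hxy)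
  · rintro ⟨⟨x, y⟩, hxy⟩
    constructor
    · rintro (rfl : x = 0)
      have : q y = 0 := by simpa using hxy
      exact ⟨⟨y, this⟩, rfl⟩
    · rintro ⟨a, ha⟩
      exact (congrArg (fun z => z.1.1) ha).symm
  · exact fun a e => ⟨fun h => h.2, fun h => ⟨AddSubgroup.zero_mem _, h⟩⟩
  · exact fun b e hb => hb.1
  · intro x
    obtain ⟨y, hy⟩ := hq.2.1 (-p x)
    exact ⟨⟨(x, y), by simp [hy]⟩, rfl⟩
  · intro x e hx
    obtain ⟨y, hy', hy⟩ := hq.2.2 (-p x) e (AddSubgroup.neg_mem _ (hp _ _ hx))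
    exact ⟨⟨(x, y), by simp [hy]⟩, ⟨hx, hy'⟩, rfl⟩

/-- If `F → N` is a graded surjection, the kernel of `F ⊕ G → N` is an extension of `G` by
`ker (F → N)`. -/
lemma isSES_ker_coprod' {F G N L : GrMod K V} {i : L →ₗ[MvPolynomial V K] F}
    {p : F →ₗ[MvPolynomial V K] N}
    {q : G →ₗ[MvPolynomial V K] N} (hp : IsSES L F N i p) (hq : IsGr q) :
    ∃ (i : L →ₗ[MvPolynomial V K] kerMod (prodMod F G) (p.coprod q))
      (j : kerMod (prodMod F G) (p.coprod q) →ₗ[MvPolynomial V K] G),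
      IsSES L (kerMod (prodMod F G) (p.coprod q)) G i j := by
  have hpi : ∀ x, p (i x) = 0 := fun x => (hp.exact _).2 ⟨x, rfl⟩
  refine ⟨(LinearMap.inl (MvPolynomial V K) F G ∘ₗ i).codRestrict _
    (fun x => by simp [hpi]), LinearMap.snd (MvPolynomial V K) F G ∘ₗ
      (LinearMap.ker (p.coprod q)).subtype, ?_, ?_, ?_, ?_, ?_, ?_⟩
  · intro x y hxy
    exact hp.inj (congrArg (fun z => z.1.1) hxy)
  · rintro ⟨⟨x, y⟩, hxy⟩
    constructor
    · rintro (rfl : y = 0)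
      have : p x = 0 := by simpa using hxy
      obtain ⟨a, rfl⟩ := (hp.exact x).1 this
      exact ⟨a, rfl⟩
    · rintro ⟨a, ha⟩
      exact (congrArg (fun z => z.1.2) ha).symm
  · exact fun a e => ⟨fun h => (hp.gr_iff _ _).1 h.1,
      fun h => ⟨(hp.gr_iff _ _).2 h, AddSubgroup.zero_mem _⟩⟩
  · exact fun b e hb => hb.2
  · intro x
    obtain ⟨y, hy⟩ := hp.surj (-q x)
    exact ⟨⟨(y, x), by simp [hy]⟩, rfl⟩
  · intro x e hx
    obtain ⟨y, hy', hy⟩ := hp.surj_gr (-q x) e (AddSubgroup.neg_mem _ (hq _ _ hx))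
    exact ⟨⟨(y, x), by simp [hy]⟩, ⟨hy', hx⟩, rfl⟩

lemma RegLE.succ {n : ℕ} : ∀ {N : GrMod K V} {r : ℕ}, RegLE n N r → RegLE n N (r + 1) := by
  induction n with
  | zero => intros; trivial
  | succ n ih =>
    intro N r h
    obtain ⟨G, q, hG, hq⟩ := h.exists_cover
    refine ⟨⟨G, q, hG.mono (Nat.le_succ r), hq⟩, fun F L f p hF hs => ?_⟩
    obtain ⟨i, j, h1⟩ := isSES_ker_coprod (p := p) hs.map_gr hq
    obtain ⟨i', j', h2⟩ := isSES_ker_coprod' hs hq.1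
    exact RegLE.sub h2 (RegLE.ext h1 (ih (h.ker hG hq))
      (RegLE.of_isFree n (hF.mono (Nat.le_succ _))))
      (RegLE.of_isFree _ (hG.mono (Nat.le_succ _)))

lemma RegLE.mono {n : ℕ} {N : GrMod K V} {r s : ℕ} (h : RegLE n N r) (hrs : r ≤ s) :
    RegLE n N s := by
  induction hrs with
  | refl => exact h
  | step _ ih => exact ih.succ

lemma RegLE.quotient {n : ℕ} {A B C : GrMod K V} {f : A →ₗ[MvPolynomial V K] B}
    {g : B →ₗ[MvPolynomial V K] C} {r : ℕ} (h : IsSES A B C f g) (hA : RegLE n A (r + 1))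
    (hB : RegLE (n + 1) B r) : RegLE (n + 1) C r := by
  obtain ⟨G, q, hG, hq⟩ := hB.exists_cover
  refine ⟨⟨G, g ∘ₗ q, hG, h.isGrSurj.comp hq⟩, fun F L i p hF hs => ?_⟩
  obtain ⟨l, hl1, hl2⟩ := hF.lift h.isGrSurj (h := p) hs.map_gr
  have hgl : g ∘ₗ l = p := LinearMap.ext hl2
  subst hgl
  have hlq : IsGrSurj (A := prodMod F G) (l.coprod q) := IsGrSurj.coprod hl1 hq
  have hK := hB.ker (hF.prod hG) hlq
  obtain ⟨i', j', h2⟩ := isSES_ker_coprod' hs (h.isGrSurj.comp hq).1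
  refine RegLE.sub h2 ?_ (RegLE.of_isFree _ hG)
  have hgc : (g ∘ₗ l).coprod (g ∘ₗ q) = g ∘ₗ (l.coprod q) := by
    rw [LinearMap.comp_coprod]
  rw [hgc]
  obtain ⟨i'', j'', h3⟩ := h.ker_comp_isSES hlq.isSES_ker
  exact RegLE.ext h3 hK hA

lemma IsFree.exists_fin {F : GrMod K V} {r : ℕ} (hF : IsFree F r) :
    ∃ (m : ℕ) (d : Fin m → ℕ) (φ : (freeMod K d : GrMod K V) →ₗ[MvPolynomial V K] F),
      (∀ k, d k ≤ r) ∧ IsGrSurj φ := by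
  obtain ⟨ι, _, d, φ, h1, h2⟩ := hF
  let e := (Fintype.equivFin ι).symm
  refine ⟨Fintype.card ι, d ∘ e,
    (φ.trans (LinearEquiv.funCongrLeft (MvPolynomial V K) (MvPolynomial V K) e)).symm.toLinearMap,
    fun k => h1 _, ?_, LinearEquiv.surjective _, ?_⟩
  · intro x j hx
    rw [← h2]
    intro i
    have := hx (e.symm i)
    simpa [LinearEquiv.funCongrLeft] using this
  · intro c j hc
    rw [← h2] at hc
    refine ⟨(φ.trans (LinearEquiv.funCongrLeft (MvPolynomial V K) (MvPolynomial V K) e)) c,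
      fun k => ?_, LinearEquiv.symm_apply_apply _ _⟩
    exact hc (e k)

/-- The regularity of the ideal `I` is at most `r`. -/
def RegIdealLE (I : Ideal (MvPolynomial V K)) (r : ℕ) : Prop :=
  ∀ n a : ℕ, RegLE n (idealMod I a) (a + r)

lemma RegIdealLE.mono {I : Ideal (MvPolynomial V K)} {r s : ℕ} (h : RegIdealLE I r)
    (hrs : r ≤ s) : RegIdealLE I s :=
  fun n a => (h n a).mono (Nat.add_le_add_left hrs a)

lemma isTwistedHomogeneous_single {ι : Type} [DecidableEq ι] (d : ι → ℕ) (k l : ι) :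
    IsTwistedHomogeneous (d l) (d k) ((Pi.single k 1 : ι → MvPolynomial V K) l) := by
  by_cases hl : l = k
  · subst hl
    rw [Pi.single_eq_same, IsTwistedHomogeneous.iff_isHomogeneous]
    right
    simpa using MvPolynomial.isHomogeneous_one V K
  · rw [Pi.single_eq_of_ne hl]
    exact .zero _ _

lemma RegIdealLE.hasResolutionDegreeBound {I : Ideal (MvPolynomial V K)} {r : ℕ}
    (h : RegIdealLE I r) : HasResolutionDegreeBound K I r := by
  have step : ∀ (i : ℕ) (N : {N : GrMod K V // ∀ n, RegLE n N (i + r)}),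
      ∃ (m : ℕ) (d : Fin m → ℕ) (φ : (freeMod K d : GrMod K V) →ₗ[MvPolynomial V K] N.1),
        (∀ k, d k ≤ i + r) ∧ IsGrSurj φ := by
    rintro i ⟨N, hN⟩
    obtain ⟨F, g, hF, hg⟩ := (hN 1).exists_cover
    obtain ⟨m, d, φ, h1, h2⟩ := hF.exists_fin
    exact ⟨m, d, g ∘ₗ φ, h1, hg.comp h2⟩
  choose m d φ hd hφ using step
  let st : ∀ i, {N : GrMod K V // ∀ n, RegLE n N (i + r)} := fun i =>
    Nat.rec (motive := fun i => {N : GrMod K V // ∀ n, RegLE n N (i + r)})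
      ⟨idealMod I 0, fun n => h n 0⟩
      (fun i N => ⟨kerMod (freeMod K (d i N)) (φ i N), fun n => by
        have := (N.2 (n + 1)).ker (isFree_freeMod (hd i N)) (hφ i N)
        rwa [Nat.add_right_comm] at this⟩) i
  let ψ : ∀ i, (Fin (m (i + 1) (st (i + 1))) → MvPolynomial V K) →ₗ[MvPolynomial V K]
      LinearMap.ker (φ i (st i)) := fun i => φ (i + 1) (st (i + 1))
  let ε : (Fin (m 0 (st 0)) → MvPolynomial V K) →ₗ[MvPolynomial V K] I := φ 0 (st 0)
  have hψ : ∀ i, Function.Surjective (ψ i) := fun i => (hφ (i + 1) (st (i + 1))).2.1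
  refine ⟨fun i => m i (st i), fun i => d i (st i),
    fun i => (LinearMap.ker (φ i (st i))).subtype ∘ₗ ψ i, I.subtype ∘ₗ ε, ?_, ?_, ?_, ?_, ?_, ?_⟩
  · intro k
    rw [← IsTwistedHomogeneous.zero_left_iff]
    exact (hφ 0 (st 0)).1 (Pi.single k 1) (d 0 (st 0) k)
      (fun l => isTwistedHomogeneous_single _ _ _)
  · intro i k l
    have h1 := (hφ (i + 1) (st (i + 1))).1 (Pi.single k 1) (d (i + 1) (st (i + 1)) k)
      (fun l => isTwistedHomogeneous_single _ _ _) l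
    rcases IsTwistedHomogeneous.iff_isHomogeneous.1 h1 with h0 | ⟨h2, h3⟩
    · have h0' : ((LinearMap.ker (φ i (st i))).subtype ∘ₗ ψ i) (Pi.single k 1) l = 0 := h0
      rw [h0']
      exact ⟨MvPolynomial.isHomogeneous_zero _ _ _, fun _ => rfl⟩
    · exact ⟨h3, fun hlt => absurd h2 (not_le.2 hlt)⟩
  · rw [LinearMap.range_comp, LinearMap.range_eq_top.2 (hφ 0 (st 0)).2.1, Submodule.map_top,
      Submodule.range_subtype]
  · rw [LinearMap.range_comp, LinearMap.range_eq_top.2 (hψ 0), Submodule.map_top,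
      Submodule.range_subtype, LinearMap.ker_comp, Submodule.ker_subtype, LinearMap.ker]
  · intro i
    rw [LinearMap.range_comp, LinearMap.range_eq_top.2 (hψ (i + 1)), Submodule.map_top,
      Submodule.range_subtype, LinearMap.ker_comp, Submodule.ker_subtype, LinearMap.ker]
  · exact fun i k => hd i (st i) k

/-- The monomial ideal spanned by the monomials with exponent vector in `U`. -/
noncomputable def monIdeal (K : Type) [Field K] {V : Type} (U : Set (V →₀ ℕ)) :
    Ideal (MvPolynomial V K) :=
  Ideal.span ((fun c => MvPolynomial.monomial c (1 : K)) '' U)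

lemma mem_monIdeal {U : Set (V →₀ ℕ)} (hU : IsUpperSet U) {p : MvPolynomial V K} :
    p ∈ monIdeal K U ↔ ∀ c ∈ p.support, c ∈ U := by
  rw [monIdeal, MvPolynomial.mem_ideal_span_monomial_image]
  exact forall₂_congr fun c _ => ⟨fun ⟨b, hb, h⟩ => hU h hb, fun h => ⟨c, h, le_rfl⟩⟩

lemma mem_support_monomial_mul {m c : V →₀ ℕ} {p : MvPolynomial V K} :
    c ∈ (MvPolynomial.monomial m 1 * p).support ↔ m ≤ c ∧ c - m ∈ p.support := by
  classical
  rw [MvPolynomial.mem_support_iff, MvPolynomial.coeff_monomial_mul', MvPolynomial.mem_support_iff]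
  split_ifs with h <;> simp [h]

lemma exists_monIdeal_decomp {U : Set (V →₀ ℕ)} {m : V →₀ ℕ} {p : MvPolynomial V K}
    (hp : ∀ c ∈ p.support, c ∈ U ∨ m ≤ c) :
    ∃ i s : MvPolynomial V K, (∀ c ∈ i.support, c ∈ U ∧ c ∈ p.support) ∧
      (∀ c ∈ s.support, c + m ∈ p.support) ∧ i - MvPolynomial.monomial m 1 * s = p := by
  classical
  let i : MvPolynomial V K :=
    ∑ c ∈ p.support.filter (· ∈ U), MvPolynomial.monomial c (p.coeff c)
  have hi : ∀ c, i.coeff c = if c ∈ U then p.coeff c else 0 := by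
    intro c
    simp only [i, MvPolynomial.coeff_sum, MvPolynomial.coeff_monomial, Finset.sum_ite_eq',
      Finset.mem_filter, MvPolynomial.mem_support_iff]
    by_cases h1 : c ∈ U <;> by_cases h2 : p.coeff c = 0 <;> simp [h1, h2]
  refine ⟨i, (i - p).divMonomial m, ?_, ?_, ?_⟩
  · intro c hc
    rw [MvPolynomial.mem_support_iff, hi] at hc
    rw [MvPolynomial.mem_support_iff]
    by_cases h : c ∈ U
    · simpa [h] using hc
    · simp [h] at hc
  · intro c hc
    rw [MvPolynomial.mem_support_iff, MvPolynomial.coeff_divMonomial, MvPolynomial.coeff_sub,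
      hi] at hc
    rw [MvPolynomial.mem_support_iff, add_comm c m]
    intro h0
    simp [h0] at hc
  · suffices h : MvPolynomial.monomial m 1 * (i - p).divMonomial m = i - p by rw [h]; ring
    ext c
    rw [MvPolynomial.coeff_monomial_mul']
    split_ifs with h
    · rw [one_mul, MvPolynomial.coeff_divMonomial, add_tsub_cancel_of_le h]
    · rw [MvPolynomial.coeff_sub, hi]
      split_ifs with h1
      · simp
      · by_contra h2
        have h3 : p.coeff c ≠ 0 := fun h4 => h2 (by simp [h4])
        exact (hp c (MvPolynomial.mem_support_iff.2 h3)).elim h1 h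

/-- The sequence `0 → (I : x^m)(-deg m) → I ⊕ S(-deg m) → I + (x^m) → 0`. -/
lemma exists_isSES_colon {U : Set (V →₀ ℕ)} (hU : IsUpperSet U) (m : V →₀ ℕ) (a : ℕ) :
    ∃ (f : idealMod (monIdeal K {c | c + m ∈ U}) (a + m.degree) →ₗ[MvPolynomial V K]
        prodMod (idealMod (monIdeal K U) a) (freeMod K (fun _ : Unit => a + m.degree)))
      (g : prodMod (idealMod (monIdeal K U) a) (freeMod K (fun _ : Unit => a + m.degree))
        →ₗ[MvPolynomial V K] idealMod (monIdeal K (U ∪ {c | m ≤ c})) a),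
      IsSES _ _ _ f g := by
  have hU1 : IsUpperSet {c | c + m ∈ U} :=
    fun b c hbc hb => hU (add_le_add_left hbc m) hb
  have hU2 : IsUpperSet (U ∪ {c | m ≤ c}) := hU.union (isUpperSet_Ici m)
  have mul_mem : ∀ p ∈ monIdeal K {c | c + m ∈ U}, MvPolynomial.monomial m 1 * p ∈ monIdeal K U := by
    intro p hp
    rw [mem_monIdeal hU1] at hp
    rw [mem_monIdeal hU]
    intro c hc
    rw [mem_support_monomial_mul] at hc
    have := hp _ hc.2
    rwa [Set.mem_ofPred_eq, tsub_add_cancel_of_le hc.1] at this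
  have of_mul_mem : ∀ p, MvPolynomial.monomial m 1 * p ∈ monIdeal K U →
      p ∈ monIdeal K {c | c + m ∈ U} := by
    intro p hp
    rw [mem_monIdeal hU] at hp
    rw [mem_monIdeal hU1]
    intro c hc
    exact hp _ (mem_support_monomial_mul.2 ⟨le_add_self, by simpa using hc⟩)
  have hle : monIdeal K U ≤ monIdeal K (U ∪ {c | m ≤ c}) :=
    Ideal.span_mono (Set.image_mono Set.subset_union_left)
  have hm : ∀ s, MvPolynomial.monomial m 1 * s ∈ monIdeal K (U ∪ {c | m ≤ c}) := fun s =>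
    Ideal.mul_mem_right _ _ (Ideal.subset_span ⟨m, Or.inr (show m ≤ m from le_rfl), rfl⟩)
  have htw : ∀ s e, IsTwistedHomogeneous (a + m.degree) e s →
      IsTwistedHomogeneous a e (MvPolynomial.monomial m (1 : K) * s) := by
    intro s e hs c hc
    rw [mem_support_monomial_mul] at hc
    have h1 := hs _ hc.2
    have h2 : (c - m + m).degree = c.degree := by rw [tsub_add_cancel_of_le hc.1]
    rw [map_add] at h2
    omega
  let f : idealMod (monIdeal K {c | c + m ∈ U}) (a + m.degree) →ₗ[MvPolynomial V K]
      prodMod (idealMod (monIdeal K U) a) (freeMod K (fun _ : Unit => a + m.degree)) :=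
    { toFun := fun p => (⟨MvPolynomial.monomial m 1 * p.1, mul_mem _ p.2⟩, fun _ => p.1)
      map_add' := fun p q => Prod.ext (Subtype.ext (mul_add _ _ _)) rfl
      map_smul' := fun p q => Prod.ext (Subtype.ext (mul_left_comm _ _ _)) rfl }
  let g : prodMod (idealMod (monIdeal K U) a) (freeMod K (fun _ : Unit => a + m.degree))
      →ₗ[MvPolynomial V K] idealMod (monIdeal K (U ∪ {c | m ≤ c})) a :=
    { toFun := fun x => ⟨x.1.1 - MvPolynomial.monomial m 1 * x.2 (),
        Ideal.sub_mem _ (hle x.1.2) (hm _)⟩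
      map_add' := fun x y => Subtype.ext (by
        simp only [Prod.fst_add, Prod.snd_add, Submodule.coe_add, Pi.add_apply]
        ring)
      map_smul' := fun p x => Subtype.ext (by
        simp only [Prod.smul_fst, Prod.smul_snd, Submodule.coe_smul, Pi.smul_apply, smul_eq_mul,
          RingHom.id_apply]
        ring) }
  have hdecomp : ∀ p ∈ monIdeal K (U ∪ {c | m ≤ c}), ∃ i s : MvPolynomial V K, i ∈ monIdeal K U ∧
      i - MvPolynomial.monomial m 1 * s = p ∧ ∀ e, IsTwistedHomogeneous a e p →
        IsTwistedHomogeneous a e i ∧ IsTwistedHomogeneous (a + m.degree) e s := by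
    intro p hp
    obtain ⟨i, s, h1, h2, h3⟩ := exists_monIdeal_decomp ((mem_monIdeal hU2).1 hp)
    refine ⟨i, s, (mem_monIdeal hU).2 fun c hc => (h1 c hc).1, h3, fun e he =>
      ⟨fun c hc => he c (h1 c hc).2, fun c hc => ?_⟩⟩
    have := he _ (h2 c hc)
    rw [map_add] at this
    omega
  refine ⟨f, g, ?_, ?_, ?_, ?_, ?_, ?_⟩
  · intro x y hxy
    exact Subtype.ext (congrFun (congrArg Prod.snd hxy) ())
  · rintro ⟨⟨i, hi⟩, s⟩
    constructor
    · intro h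
      have h1 : i = MvPolynomial.monomial m 1 * s () := sub_eq_zero.1 (congrArg Subtype.val h)
      exact ⟨⟨s (), of_mul_mem _ (h1 ▸ hi)⟩, Prod.ext (Subtype.ext h1.symm) rfl⟩
    · rintro ⟨p, hp⟩
      rw [← hp]
      exact Subtype.ext (sub_self _)
  · intro p e
    exact ⟨fun h => h.2 (), fun h => ⟨htw _ _ h, fun _ => h⟩⟩
  · intro x e hx
    have h1 : IsTwistedHomogeneous a e x.1.1 := hx.1
    have h2 := htw _ _ (hx.2 ())
    have h3 := h1.add h2.neg
    rw [← sub_eq_add_neg] at h3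
    exact h3
  · rintro ⟨p, hp⟩
    obtain ⟨i, s, h1, h2, -⟩ := hdecomp p hp
    exact ⟨(⟨i, h1⟩, fun _ => s), Subtype.ext h2⟩
  · rintro ⟨p, hp⟩ e he
    obtain ⟨i, s, h1, h2, h3⟩ := hdecomp p hp
    exact ⟨(⟨i, h1⟩, fun _ => s), ⟨(h3 e he).1, fun _ => (h3 e he).2⟩, Subtype.ext h2⟩

/-- `reg I ≤ max (reg (I : x^m) + deg m) (reg (I + (x^m)))`. -/
lemma RegIdealLE.of_colon {U : Set (V →₀ ℕ)} (hU : IsUpperSet U) (m : V →₀ ℕ) {r : ℕ}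
    (h1 : RegIdealLE (monIdeal K {c | c + m ∈ U}) r)
    (h2 : RegIdealLE (monIdeal K (U ∪ {c | m ≤ c})) (r + m.degree)) :
    RegIdealLE (monIdeal K U) (r + m.degree) := by
  intro n a
  obtain ⟨f, g, hs⟩ := exists_isSES_colon (K := K) hU m a
  refine RegLE.summand (RegLE.ext hs ?_ (h2 n a)) (isFree_freeMod fun _ => by omega)
  have := h1 n (a + m.degree)
  rwa [show a + m.degree + r = a + (r + m.degree) by ring] at this

/-- `reg (I + (x^m)) ≤ max (reg I) (reg (I : x^m) + deg m - 1)`. -/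
lemma RegIdealLE.add_monomial {U : Set (V →₀ ℕ)} (hU : IsUpperSet U) (m : V →₀ ℕ) {r : ℕ}
    (hr : m.degree ≤ r) (h1 : RegIdealLE (monIdeal K {c | c + m ∈ U}) (r + 1 - m.degree))
    (h2 : RegIdealLE (monIdeal K U) r) : RegIdealLE (monIdeal K (U ∪ {c | m ≤ c})) r := by
  intro n a
  cases n with
  | zero => trivial
  | succ n =>
    obtain ⟨f, g, hs⟩ := exists_isSES_colon (K := K) hU m a
    refine RegLE.quotient hs ?_ ((h2 (n + 1) a).prod
      (RegLE.of_isFree _ (isFree_freeMod fun _ => by omega)))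
    have := h1 n (a + m.degree)
    rwa [show a + m.degree + (r + 1 - m.degree) = a + r + 1 by omega] at this

lemma RegIdealLE.univ : RegIdealLE (monIdeal K (Set.univ : Set (V →₀ ℕ))) 0 := by
  intro n a
  refine RegLE.of_isFree n ⟨Unit, inferInstance, fun _ => a, ?_⟩
  have htop : monIdeal K (Set.univ : Set (V →₀ ℕ)) = ⊤ :=
    (Ideal.eq_top_iff_one _).2 ((mem_monIdeal isUpperSet_univ).2 fun c _ => Set.mem_univ c)
  refine ⟨(LinearEquiv.ofTop _ htop).trans
    (LinearEquiv.funUnique Unit (MvPolynomial V K) (MvPolynomial V K)).symm, fun _ => le_rfl, ?_⟩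
  exact fun x e => ⟨fun h => h (), fun h _ => h⟩

lemma RegIdealLE.empty : RegIdealLE (monIdeal K (∅ : Set (V →₀ ℕ))) 0 := by
  intro n a
  refine RegLE.of_isFree n ⟨Empty, inferInstance, fun _ => a, ?_⟩
  have hbot : monIdeal K (∅ : Set (V →₀ ℕ)) = ⊥ := by simp [monIdeal]
  have : Subsingleton (monIdeal K (∅ : Set (V →₀ ℕ))) := by
    rw [hbot]; infer_instance
  refine ⟨LinearEquiv.ofSubsingleton _ _, fun _ => le_rfl, fun x e => ?_⟩
  refine ⟨fun _ => ?_, fun _ i => i.elim⟩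
  rw [Subsingleton.elim x 0]
  exact AddSubgroup.zero_mem _

end GradedModules

section AlternatingPaths

variable {V : Type} {G : SimpleGraph V}

/-- `EvenPath G A u q`: a walk from `u` to `q` alternating between edges of `G` and the edges
in the multiset `A`, starting with an edge of `G` and ending with an edge in `A`. -/
inductive EvenPath (G : SimpleGraph V) : Multiset (Sym2 V) → V → V → Prop
  | nil (u : V) : EvenPath G 0 u u
  | snoc {A : Multiset (Sym2 V)} {u q p q' : V} :
      EvenPath G A u q → G.Adj q p → EvenPath G (s(p, q') ::ₘ A) u q'

/-- An alternating walk that starts and ends with an edge of `G`. -/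
def AltPath (G : SimpleGraph V) (A : Multiset (Sym2 V)) (u v : V) : Prop :=
  ∃ q, EvenPath G A u q ∧ G.Adj q v

lemma EvenPath.trans {A B : Multiset (Sym2 V)} {u q r : V} (h1 : EvenPath G A u q)
    (h2 : EvenPath G B q r) : EvenPath G (A + B) u r := by
  induction h2 with
  | nil => simpa using h1
  | snoc _ hadj ih => simpa using (ih h1).snoc hadj

lemma EvenPath.single {u p q : V} (h : G.Adj u p) : EvenPath G {s(p, q)} u q :=
  (EvenPath.nil u).snoc h

lemma EvenPath.cons {A : Multiset (Sym2 V)} {u p q r : V} (h : G.Adj u p)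
    (h2 : EvenPath G A q r) : EvenPath G (s(p, q) ::ₘ A) u r :=
  (EvenPath.single h).trans h2

lemma EvenPath.trans_altPath {A B : Multiset (Sym2 V)} {u q v : V} (h1 : EvenPath G A u q)
    (h2 : AltPath G B q v) : AltPath G (A + B) u v :=
  let ⟨r, h3, h4⟩ := h2
  ⟨r, h1.trans h3, h4⟩

lemma AltPath.of_adj {u v : V} (h : G.Adj u v) : AltPath G 0 u v := ⟨u, .nil u, h⟩

lemma AltPath.cons {A : Multiset (Sym2 V)} {u p q v : V} (h : G.Adj u p)
    (h2 : AltPath G A q v) : AltPath G (s(p, q) ::ₘ A) u v :=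
  (EvenPath.single h).trans_altPath h2

lemma AltPath.symm {A : Multiset (Sym2 V)} {u v : V} (h : AltPath G A u v) :
    AltPath G A v u := by
  obtain ⟨q, h, hadj⟩ := h
  induction h generalizing v with
  | nil => exact .of_adj hadj.symm
  | @snoc A u q p q' _ h1 ih =>
    rw [Sym2.eq_swap]
    exact .cons hadj.symm (ih h1)

lemma EvenPath.split {A : Multiset (Sym2 V)} {u q t : V} {e : Sym2 V} (h : EvenPath G A u q)
    (he : e ∈ A) (ht : t ∈ e) : ∃ t' A₁ A₂, e = s(t, t') ∧ A = e ::ₘ (A₁ + A₂) ∧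
      (AltPath G A₁ u t ∧ EvenPath G A₂ t' q ∨ AltPath G A₁ u t' ∧ EvenPath G A₂ t q) := by
  induction h with
  | nil => simp at he
  | @snoc A u q p q' h hadj ih =>
    rcases Multiset.mem_cons.1 he with rfl | he
    · rcases Sym2.mem_iff.1 ht with rfl | rfl
      · exact ⟨q', A, 0, rfl, by simp, .inl ⟨⟨q, h, hadj⟩, .nil _⟩⟩
      · exact ⟨p, A, 0, Sym2.eq_swap, by simp, .inr ⟨⟨q, h, hadj⟩, .nil _⟩⟩
    · obtain ⟨t', A₁, A₂, h1, rfl, h3⟩ := ih he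
      refine ⟨t', A₁, s(p, q') ::ₘ A₂, h1, ?_, ?_⟩
      · rw [Multiset.add_cons, Multiset.cons_swap]
      · exact h3.imp (fun h => ⟨h.1, h.2.snoc hadj⟩) (fun h => ⟨h.1, h.2.snoc hadj⟩)

lemma AltPath.split {A : Multiset (Sym2 V)} {u v t : V} {e : Sym2 V} (h : AltPath G A u v)
    (he : e ∈ A) (ht : t ∈ e) : ∃ t' A₁ A₂, e = s(t, t') ∧ A = e ::ₘ (A₁ + A₂) ∧
      (AltPath G A₁ u t ∧ AltPath G A₂ t' v ∨ AltPath G A₁ u t' ∧ AltPath G A₂ t v) := by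
  obtain ⟨q, h, hadj⟩ := h
  obtain ⟨t', A₁, A₂, h1, h2, h3⟩ := h.split he ht
  exact ⟨t', A₁, A₂, h1, h2, h3.imp (fun h => ⟨h.1, q, h.2, hadj⟩) (fun h => ⟨h.1, q, h.2, hadj⟩)⟩

/-- Two vertices are joined by an alternating walk that uses the edges in `M`. -/
def AltAdj (G : SimpleGraph V) (M : Multiset (Sym2 V)) (u v : V) : Prop :=
  ∃ A ≤ M, AltPath G A u v

lemma AltAdj.symm {M : Multiset (Sym2 V)} {u v : V} (h : AltAdj G M u v) : AltAdj G M v u :=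
  let ⟨A, hA, h⟩ := h
  ⟨A, hA, h.symm⟩

/-- `t` lies on an alternating walk whose end points are not in `Z`. -/
def Touched (G : SimpleGraph V) (M : Multiset (Sym2 V)) (Z : Set V) (t : V) : Prop :=
  ∃ B ≤ M, ∃ u v, AltPath G B u v ∧ u ∉ Z ∧ v ∉ Z ∧ (t = u ∨ ∃ e ∈ B, t ∈ e)

variable {M : Multiset (Sym2 V)}

lemma Touched.anti {Z Z' : Set V} (h : Z ⊆ Z') {t : V} (ht : Touched G M Z' t) :
    Touched G M Z t :=
  let ⟨B, hB, u, v, h1, h2, h3, h4⟩ := ht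
  ⟨B, hB, u, v, h1, fun h5 => h2 (h h5), fun h5 => h3 (h h5), h4⟩

lemma AltAdj.touched {Z : Set V} {u v : V} (h : AltAdj G M u v) (hu : u ∉ Z) (hv : v ∉ Z) :
    Touched G M Z u :=
  let ⟨A, hA, h⟩ := h
  ⟨A, hA, u, v, h, hu, hv, .inl rfl⟩

variable {Z : Set V} {x : V}

lemma EvenPath.not_on_path (hZ : ∀ v, AltAdj G M x v → v ∈ Z) {A B : Multiset (Sym2 V)}
    {q u v : V} (h : EvenPath G A x q) (hB : AltPath G B u v) (hu : u ∉ Z) (hv : v ∉ Z)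
    (hAB : A + B ≤ M) : ¬ (q = u ∨ ∃ e ∈ B, q ∈ e) ∧
      ∀ w, G.Adj q w → ¬ (w = u ∨ ∃ e ∈ B, w ∈ e) := by
  have key : ∀ C ≤ B, ∀ a b, (b = u ∨ b = v) → AltPath G C a b → ¬ EvenPath G A x a := by
    rintro C hC a b hb h1 h2
    have := hZ b ⟨A + C, (by gcongr : A + C ≤ A + B).trans hAB, h2.trans_altPath h1⟩
    rcases hb with rfl | rfl <;> contradiction
  refine ⟨?_, ?_⟩
  · rintro (rfl | ⟨e, he, hq⟩)
    · exact key B le_rfl _ _ (.inr rfl) hB h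
    · obtain ⟨t', B₁, B₂, -, h2, h3 | h3⟩ := hB.split he hq
      · exact key B₁ (by rw [h2]; exact (Multiset.le_add_right _ _).trans (Multiset.le_cons_self _ _))
          _ _ (.inl rfl) h3.1.symm h
      · exact key B₂ (by rw [h2]; exact (Multiset.le_add_left _ _).trans (Multiset.le_cons_self _ _))
          _ _ (.inr rfl) h3.2 h
  · rintro w hw (rfl | ⟨e, he, hq⟩)
    · exact hu (hZ w ⟨A, (Multiset.le_add_right _ _).trans hAB, q, h, hw⟩)
    · obtain ⟨t', B₁, B₂, rfl, h2, h3 | h3⟩ := hB.split he hq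
      · exact key (s(w, t') ::ₘ B₂) (by
          rw [h2]; exact Multiset.cons_le_cons _ (Multiset.le_add_left _ _))
          _ _ (.inr rfl) (.cons hw h3.2) h
      · exact key (s(w, t') ::ₘ B₁) (by
          rw [h2]; exact Multiset.cons_le_cons _ (Multiset.le_add_right _ _))
          _ _ (.inl rfl) (.cons hw h3.1.symm) h

lemma EvenPath.add_le (hZ : ∀ v, AltAdj G M x v → v ∈ Z) {A B : Multiset (Sym2 V)}
    {q u v : V} (h : EvenPath G A x q) (hA : A ≤ M) (hB : AltPath G B u v) (hBM : B ≤ M)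
    (hu : u ∉ Z) (hv : v ∉ Z) : A + B ≤ M := by
  classical
  induction h with
  | nil => simpa using hBM
  | @snoc A x q p q' h hadj ih =>
    have h1 := ih hZ ((Multiset.le_cons_self _ _).trans hA)
    have h2 := (h.not_on_path hZ hB hu hv h1).2 p hadj
    have h3 : s(p, q') ∉ B := fun h3 => h2 (.inr ⟨_, h3, Sym2.mem_mk_left _ _⟩)
    rw [Multiset.le_iff_count] at h1 hA ⊢
    intro e
    have h1 := h1 e
    have hA := hA e
    simp only [Multiset.count_add, Multiset.count_cons] at *
    split_ifs at * with he
    · rw [he, Multiset.count_eq_zero_of_notMem h3, ← he]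
      omega
    · omega

/-- If `Z` contains everything reachable from `x`, then no walk avoiding `Z` at its ends meets
an even walk starting at `x` or a neighbour of such a walk. -/
lemma EvenPath.not_touched (hZ : ∀ v, AltAdj G M x v → v ∈ Z) {A : Multiset (Sym2 V)} {q : V}
    (h : EvenPath G A x q) (hA : A ≤ M) :
    ¬ Touched G M Z q ∧ ∀ w, G.Adj q w → ¬ Touched G M Z w := by
  constructor
  · rintro ⟨B, hB, u, v, h1, h2, h3, h4⟩
    exact (h.not_on_path hZ h1 h2 h3 (h.add_le hZ hA h1 hB h2 h3)).1 h4
  · rintro w hw ⟨B, hB, u, v, h1, h2, h3, h4⟩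
    exact (h.not_on_path hZ h1 h2 h3 (h.add_le hZ hA h1 hB h2 h3)).2 w hw h4

lemma AltPath.not_touched (hZ : ∀ v, AltAdj G M x v → v ∈ Z) {A : Multiset (Sym2 V)} {v t : V}
    {e : Sym2 V} (h : AltPath G A x v) (hA : A ≤ M) (he : e ∈ A) (ht : t ∈ e) :
    ¬ Touched G M Z t := by
  obtain ⟨t', A₁, A₂, rfl, rfl, h3 | h3⟩ := h.split he ht
  · obtain ⟨q, h4, h5⟩ := h3.1
    exact (h4.not_touched hZ (((Multiset.le_add_right _ _).trans
      (Multiset.le_cons_self _ _)).trans hA)).2 t h5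
  · obtain ⟨q, h4, h5⟩ := h3.1
    have h6 : EvenPath G (s(t, t') ::ₘ A₁) x t := by
      rw [Sym2.eq_swap]
      exact h4.snoc h5
    exact (h6.not_touched hZ ((Multiset.cons_le_cons _ (Multiset.le_add_right _ _)).trans hA)).1

/-- An alternating walk whose ends avoid a vertex cover `C` uses an edge with both ends
in `C`. -/
lemma AltPath.exists_mem_cover {C : Set V} (hC : ∀ u v, G.Adj u v → u ∈ C ∨ v ∈ C)
    {A : Multiset (Sym2 V)} {u v : V} (h : AltPath G A u v) (hu : u ∉ C) (hv : v ∉ C) :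
    ∃ p q, s(p, q) ∈ A ∧ p ∈ C ∧ q ∈ C := by
  obtain ⟨r, h, hadj⟩ := h
  by_contra! hne
  suffices hr : r ∉ C from (hC _ _ hadj).elim hr hv
  clear hadj
  induction h with
  | nil => exact hu
  | @snoc A u q p q' h hadj ih =>
    have h1 := ih hu fun a b hab => hne a b (Multiset.mem_cons_of_mem hab)
    exact hne p q' (Multiset.mem_cons_self _ _) ((hC _ _ hadj).resolve_left h1)

end AlternatingPaths

section QuadricBound

variable {K : Type} [Field K] {V : Type} {G : SimpleGraph V} {M : Multiset (Sym2 V)}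

/-- Exponents of the monomials in the ideal generated by the products `x_u x_v` with `R u v`
and the variables `x_z` with `z ∈ Z`. -/
def quadSet (R : V → V → Prop) (Z : Set V) : Set (V →₀ ℕ) :=
  {w | (∃ u v, R u v ∧ Finsupp.single u 1 + Finsupp.single v 1 ≤ w) ∨ ∃ z ∈ Z, 1 ≤ w z}

lemma isUpperSet_quadSet (R : V → V → Prop) (Z : Set V) : IsUpperSet (quadSet R Z) := by
  rintro a b hab (⟨u, v, h1, h2⟩ | ⟨z, h1, h2⟩)
  · exact .inl ⟨u, v, h1, h2.trans hab⟩
  · exact .inr ⟨z, h1, h2.trans (hab z)⟩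

lemma quadSet_union_single (R : V → V → Prop) (Z : Set V) (x : V) :
    quadSet R Z ∪ {c | Finsupp.single x 1 ≤ c} = quadSet R (insert x Z) := by
  ext c
  simp only [quadSet, Set.mem_union, Set.mem_ofPred_eq, Set.mem_insert_iff, Finsupp.single_le_iff,
    exists_eq_or_imp]
  rw [or_assoc]
  exact or_congr_right or_comm

lemma quadSet_colon_single {R : V → V → Prop} (hR : ∀ u v, R u v → R v u) {Z : Set V} {x : V}
    (hx : x ∉ Z) :
    {c | c + Finsupp.single x 1 ∈ quadSet R Z} = quadSet R (Z ∪ {v | R x v}) := by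
  classical
  ext c
  constructor
  · rintro (⟨u, v, h1, h2⟩ | ⟨z, h1, h2⟩)
    · by_cases hu : u = x
      · subst hu
        refine .inr ⟨v, .inr h1, ?_⟩
        rw [add_comm, add_le_add_iff_right, Finsupp.single_le_iff] at h2
        exact h2
      by_cases hv : v = x
      · subst hv
        refine .inr ⟨u, .inr (hR _ _ h1), ?_⟩
        rw [add_le_add_iff_right, Finsupp.single_le_iff] at h2
        exact h2
      refine .inl ⟨u, v, h1, fun a => ?_⟩
      have := h2 a
      by_cases ha : a = x
      · subst ha
        simp [hu, hv]
      · simpa [Finsupp.single_apply, Ne.symm ha] using this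
    · refine .inr ⟨z, .inl h1, ?_⟩
      have hz : x ≠ z := fun h => hx (h ▸ h1)
      simpa [Finsupp.single_apply, hz] using h2
  · rintro (⟨u, v, h1, h2⟩ | ⟨z, h1 | h1, h2⟩)
    · exact .inl ⟨u, v, h1, h2.trans le_self_add⟩
    · exact .inr ⟨z, h1, h2.trans (Nat.le_add_right _ _)⟩
    · refine .inl ⟨x, z, h1, ?_⟩
      rw [add_comm, add_le_add_iff_right, Finsupp.single_le_iff]
      exact h2

/-- An ideal generated by variables has regularity at most one. -/
lemma RegIdealLE.quadSet_of_forall [Finite V] {R : V → V → Prop} {Z : Set V}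
    (h : ∀ u v, R u v → u ∈ Z ∨ v ∈ Z) : RegIdealLE (monIdeal K (quadSet R Z)) 1 := by
  have h0 : quadSet R Z = quadSet (fun _ _ => False) Z := by
    ext c
    constructor
    · rintro (⟨u, v, h1, h2⟩ | h2)
      · rcases h u v h1 with h3 | h3
        · exact .inr ⟨u, h3, Finsupp.single_le_iff.1 (le_self_add.trans h2)⟩
        · exact .inr ⟨v, h3, Finsupp.single_le_iff.1 (le_add_self.trans h2)⟩
      · exact .inr h2
    · rintro (⟨u, v, h1, h2⟩ | h2)
      · exact h1.elim
      · exact .inr h2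
  rw [h0]
  clear h h0
  induction Z, Z.toFinite using Set.Finite.induction_on with
  | empty =>
    have : quadSet (fun _ _ => False) (∅ : Set V) = ∅ := by ext c; simp [quadSet]
    rw [this]
    exact RegIdealLE.empty.mono zero_le_one
  | @insert x Z hx _ ih =>
    rw [← quadSet_union_single]
    refine RegIdealLE.add_monomial (isUpperSet_quadSet _ _) _ (by simp) ?_ ih
    simpa [quadSet_colon_single (R := fun _ _ => False) (fun _ _ h => h) hx] using ih

lemma RegIdealLE.quadSet_step {R : V → V → Prop} (hR : ∀ u v, R u v → R v u) {Z : Set V}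
    {x : V} (hx : x ∉ Z) {r : ℕ} (h1 : RegIdealLE (monIdeal K (quadSet R (Z ∪ {v | R x v}))) r)
    (h2 : RegIdealLE (monIdeal K (quadSet R (insert x Z))) (r + 1)) :
    RegIdealLE (monIdeal K (quadSet R Z)) (r + 1) := by
  have hdeg : (Finsupp.single x 1 : V →₀ ℕ).degree = 1 := by simp
  rw [← quadSet_colon_single hR hx] at h1
  rw [← quadSet_union_single] at h2
  have := RegIdealLE.of_colon (isUpperSet_quadSet R Z) (Finsupp.single x 1) h1
  rw [hdeg] at this
  exact this h2

variable [Finite V]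

lemma ncard_compl_insert_lt {Z : Set V} {x : V} (hx : x ∉ Z) :
    (insert x Z)ᶜ.ncard < Zᶜ.ncard :=
  Set.ncard_lt_ncard (compl_lt_compl_iff_lt.2 (Set.ssubset_insert hx)) (Set.toFinite _)

lemma RegIdealLE.quadSet_of_touched_subset (hM : ∀ e ∈ M, e ∈ G.edgeSet) {C : Set V}
    (hC : ∀ u v, G.Adj u v → u ∈ C ∨ v ∈ C) {j : ℕ} {Z : Set V}
    (hCZ : ∀ t ∈ C, Touched G M Z t → t ∈ Z)
    (hj : (C ∩ {t | Touched G M Z t}).ncard ≤ 2 * j) :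
    RegIdealLE (monIdeal K (quadSet (AltAdj G M) Z)) (j + 1) := by
  induction hn : j + Zᶜ.ncard using Nat.strong_induction_on generalizing j Z with
  | _ n ih =>
  subst hn
  by_cases h0 : ∀ u v, AltAdj G M u v → u ∈ Z ∨ v ∈ Z
  · exact (RegIdealLE.quadSet_of_forall h0).mono (by omega)
  push Not at h0
  obtain ⟨y, v, hyv, hy, hv⟩ := h0
  obtain ⟨A, hA, hpath⟩ := hyv
  have hty : Touched G M Z y := AltAdj.touched ⟨A, hA, hpath⟩ hy hv
  have htv : Touched G M Z v := AltAdj.touched ⟨A, hA, hpath.symm⟩ hv hy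
  obtain ⟨p, q, hpq, hp, hq⟩ := hpath.exists_mem_cover hC (fun h => hy (hCZ y h hty))
    (fun h => hv (hCZ v h htv))
  have hne : p ≠ q := (hM _ (Multiset.mem_of_le hA hpq) : G.Adj p q).ne
  set Z' := Z ∪ {v | AltAdj G M y v} with hZ'
  have hsub : C ∩ {t | Touched G M Z' t} ∪ {p, q} ⊆ C ∩ {t | Touched G M Z t} := by
    rintro t (⟨h1, h2⟩ | rfl | rfl)
    · exact ⟨h1, Touched.anti Set.subset_union_left h2⟩
    · exact ⟨hp, A, hA, y, v, hpath, hy, hv, .inr ⟨_, hpq, Sym2.mem_mk_left _ _⟩⟩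
    · exact ⟨hq, A, hA, y, v, hpath, hy, hv, .inr ⟨_, hpq, Sym2.mem_mk_right _ _⟩⟩
  have hdisj : Disjoint (C ∩ {t | Touched G M Z' t}) {p, q} := by
    rw [Set.disjoint_right]
    rintro t (rfl | rfl) ⟨-, h2⟩
    · exact hpath.not_touched (fun v h => .inr h) hA hpq (Sym2.mem_mk_left _ _) h2
    · exact hpath.not_touched (fun v h => .inr h) hA hpq (Sym2.mem_mk_right _ _) h2
  have hcard := Set.ncard_le_ncard hsub (Set.toFinite _)
  rw [Set.ncard_union_eq hdisj (Set.toFinite _) (Set.toFinite _), Set.ncard_pair hne] at hcard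
  obtain ⟨j, rfl⟩ : ∃ i, j = i + 1 := ⟨j - 1, by omega⟩
  refine RegIdealLE.quadSet_step (fun _ _ h => h.symm) hy
    (ih _ ?_ (Z := Z') ?_ ?_ rfl) (ih _ ?_ ?_ ?_ rfl)
  · have : Z'ᶜ.ncard ≤ Zᶜ.ncard :=
      Set.ncard_le_ncard (Set.compl_subset_compl.2 Set.subset_union_left) (Set.toFinite _)
    omega
  · exact fun t ht h => .inl (hCZ t ht (h.anti Set.subset_union_left))
  · omega
  · have := ncard_compl_insert_lt hy
    omega
  · exact fun t ht h => .inr (hCZ t ht (h.anti (Set.subset_insert _ _)))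
  · exact (Set.ncard_le_ncard (Set.inter_subset_inter_right _
      fun t ht => Touched.anti (Set.subset_insert _ _) ht) (Set.toFinite _)).trans hj

lemma ncard_inter_touched_le {E₀ : Set (Sym2 V)} {P : V → Prop} :
    ({t | ∃ e ∈ E₀, t ∈ e} ∩ {t | P t}).ncard ≤ 2 * {e ∈ E₀ | ∃ t ∈ e, P t}.ncard := by
  classical
  have := Fintype.ofFinite V
  set F := {e ∈ E₀ | ∃ t ∈ e, P t} with hF
  have hfin : F.Finite := Set.toFinite _
  rw [Set.ncard_eq_toFinset_card F hfin]
  calc _ ≤ ((hfin.toFinset.biUnion fun e => e.toFinset : Finset V) : Set V).ncard := by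
        refine Set.ncard_le_ncard ?_ (Set.toFinite _)
        rintro t ⟨⟨e, he, ht⟩, hP⟩
        simp only [Finset.coe_biUnion, Set.mem_iUnion, Finset.mem_coe, Set.Finite.mem_toFinset,
          Sym2.mem_toFinset]
        exact ⟨e, ⟨he, t, ht, hP⟩, ht⟩
    _ ≤ _ := by
        rw [Set.ncard_coe_finset, mul_comm]
        refine Finset.card_biUnion_le_card_mul _ _ _ fun e _ => ?_
        by_cases he : e.IsDiag
        · rw [Sym2.card_toFinset_of_isDiag _ he]; omega
        · rw [Sym2.card_toFinset_of_not_isDiag _ he]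

/-- Regularity bound for the ideals `(I(G)^(t+1) : m)` plus variables, where `m` is the product
of the edges in `M` and every edge of `G` meets one of the edges in `E₀`. -/
lemma RegIdealLE.quadSet_altAdj (hM : ∀ e ∈ M, e ∈ G.edgeSet) {E₀ : Set (Sym2 V)}
    (hE₀ : E₀ ⊆ G.edgeSet) (hcov : ∀ u v, G.Adj u v → ∃ e ∈ E₀, u ∈ e ∨ v ∈ e) {j : ℕ} {Z : Set V}
    (hj : {e ∈ E₀ | ∃ t ∈ e, Touched G M Z t}.ncard ≤ j) :
    RegIdealLE (monIdeal K (quadSet (AltAdj G M) Z)) (j + 1) := by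
  induction hn : j + Zᶜ.ncard using Nat.strong_induction_on generalizing j Z with
  | _ n ih =>
  subst hn
  by_cases h0 : ∀ t ∈ {t | ∃ e ∈ E₀, t ∈ e}, Touched G M Z t → t ∈ Z
  · refine RegIdealLE.quadSet_of_touched_subset hM ?_ h0
      (ncard_inter_touched_le.trans (Nat.mul_le_mul_left 2 hj))
    intro u v h
    obtain ⟨e, he, h1 | h1⟩ := hcov u v h
    exacts [.inl ⟨e, he, h1⟩, .inr ⟨e, he, h1⟩]
  push Not at h0
  obtain ⟨x, ⟨e, he, hxe⟩, htx, hx⟩ := h0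
  obtain ⟨b, rfl⟩ := Sym2.mem_iff_exists.1 hxe
  set Z' := Z ∪ {v | AltAdj G M x v} with hZ'
  have hlt : {e ∈ E₀ | ∃ t ∈ e, Touched G M Z' t}.ncard <
      {e ∈ E₀ | ∃ t ∈ e, Touched G M Z t}.ncard := by
    refine Set.ncard_lt_ncard ((Set.ssubset_iff_of_subset ?_).2
      ⟨s(x, b), ⟨he, x, hxe, htx⟩, ?_⟩) (Set.toFinite _)
    · rintro f ⟨h1, t, h2, h3⟩
      exact ⟨h1, t, h2, h3.anti Set.subset_union_left⟩
    · rintro ⟨-, t, h2, h3⟩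
      have h4 := (EvenPath.nil (G := G) x).not_touched (M := M) (Z := Z') (fun v h => .inr h)
        (Multiset.zero_le _)
      rcases Sym2.mem_iff.1 h2 with rfl | rfl
      · exact h4.1 h3
      · exact h4.2 t (hE₀ he) h3
  obtain ⟨j, rfl⟩ : ∃ i, j = i + 1 := ⟨j - 1, by omega⟩
  refine RegIdealLE.quadSet_step (fun _ _ h => h.symm) hx (ih _ ?_ (Z := Z') ?_ rfl) (ih _ ?_ ?_ rfl)
  · have : Z'ᶜ.ncard ≤ Zᶜ.ncard :=
      Set.ncard_le_ncard (Set.compl_subset_compl.2 Set.subset_union_left) (Set.toFinite _)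
    omega
  · omega
  · have := ncard_compl_insert_lt hx
    omega
  · refine (Set.ncard_le_ncard ?_ (Set.toFinite _)).trans hj
    rintro f ⟨h1, t, h2, h3⟩
    exact ⟨h1, t, h2, h3.anti (Set.subset_insert _ _)⟩

end QuadricBound

section Exchange

variable {V : Type} {G : SimpleGraph V}

/-- The exponent vector of the monomial of an edge. -/
noncomputable def edgeVec : Sym2 V → V →₀ ℕ :=
  Sym2.lift ⟨fun u v => Finsupp.single u 1 + Finsupp.single v 1, fun _ _ => add_comm _ _⟩

lemma edgeVec_mk (u v : V) : edgeVec s(u, v) = Finsupp.single u 1 + Finsupp.single v 1 := rfl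

/-- The exponent vector of a product of edges. -/
noncomputable def edgeSum (N : Multiset (Sym2 V)) : V →₀ ℕ := (N.map edgeVec).sum

lemma edgeSum_zero : edgeSum (0 : Multiset (Sym2 V)) = 0 := rfl

lemma edgeSum_cons (e : Sym2 V) (N : Multiset (Sym2 V)) :
    edgeSum (e ::ₘ N) = edgeVec e + edgeSum N := by simp [edgeSum]

lemma edgeSum_add (N N' : Multiset (Sym2 V)) : edgeSum (N + N') = edgeSum N + edgeSum N' := by
  simp [edgeSum]

lemma degree_edgeSum (N : Multiset (Sym2 V)) : (edgeSum N).degree = 2 * N.card := by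
  induction N using Multiset.induction_on with
  | empty => simp [edgeSum_zero]
  | cons e N ih =>
    obtain ⟨u, v⟩ := e
    rw [edgeSum_cons, map_add, ih, edgeVec_mk, map_add, Multiset.card_cons]
    simp
    ring

lemma exists_mem_of_edgeSum_pos {N : Multiset (Sym2 V)} {u : V} (h : 0 < edgeSum N u) :
    ∃ v N', N = s(u, v) ::ₘ N' := by
  classical
  induction N using Multiset.induction_on with
  | empty => simp [edgeSum_zero] at h
  | cons e N ih =>
    obtain ⟨a, b⟩ := e
    by_cases ha : a = u
    · subst ha
      exact ⟨b, N, rfl⟩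
    by_cases hb : b = u
    · subst hb
      exact ⟨a, N, by rw [Sym2.eq_swap]⟩
    have h1 : 0 < edgeSum N u := by
      simpa [edgeSum_cons, edgeVec_mk, Finsupp.single_apply, ha, hb] using h
    obtain ⟨v, N', rfl⟩ := ih h1
    exact ⟨v, s(a, b) ::ₘ N', Multiset.cons_swap _ _ _⟩

/-- Exchanging the edges along an even alternating walk. -/
lemma EvenPath.exists_edgeSum {A : Multiset (Sym2 V)} {u q : V} (h : EvenPath G A u q) :
    ∃ N : Multiset (Sym2 V), N.card = A.card ∧ (∀ e ∈ N, e ∈ G.edgeSet) ∧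
      edgeSum N + Finsupp.single q 1 = edgeSum A + Finsupp.single u 1 := by
  induction h with
  | nil => exact ⟨0, rfl, by simp, rfl⟩
  | @snoc A u q p q' h hadj ih =>
    obtain ⟨N, h1, h2, h3⟩ := ih
    refine ⟨s(q, p) ::ₘ N, by simp [h1], ?_, ?_⟩
    · intro e he
      rcases Multiset.mem_cons.1 he with rfl | he
      exacts [hadj, h2 e he]
    · rw [edgeSum_cons, edgeSum_cons, edgeVec_mk, edgeVec_mk, add_assoc _ (edgeSum A), ← h3]
      abel

variable {M : Multiset (Sym2 V)}

lemma EvenPath.exists_edgeSum_of_le (hM : ∀ e ∈ M, e ∈ G.edgeSet) {A : Multiset (Sym2 V)}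
    {u q : V} (h : EvenPath G A u q) (hA : A ≤ M) :
    ∃ N : Multiset (Sym2 V), N.card = M.card ∧ (∀ e ∈ N, e ∈ G.edgeSet) ∧
      edgeSum N + Finsupp.single q 1 = edgeSum M + Finsupp.single u 1 := by
  obtain ⟨B, rfl⟩ := Multiset.le_iff_exists_add.1 hA
  obtain ⟨N, h1, h2, h3⟩ := h.exists_edgeSum
  refine ⟨N + B, by simp [h1], ?_, ?_⟩
  · intro e he
    rcases Multiset.mem_add.1 he with he | he
    exacts [h2 e he, hM e (Multiset.mem_add.2 (.inr he))]
  · rw [edgeSum_add, edgeSum_add, add_right_comm, h3, add_right_comm]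

lemma AltAdj.exists_edgeSum (hM : ∀ e ∈ M, e ∈ G.edgeSet) {u v : V} (h : AltAdj G M u v) :
    ∃ N : Multiset (Sym2 V), N.card = M.card + 1 ∧ (∀ e ∈ N, e ∈ G.edgeSet) ∧
      edgeSum N = edgeSum M + (Finsupp.single u 1 + Finsupp.single v 1) := by
  obtain ⟨A, hA, q, h, hadj⟩ := h
  obtain ⟨N, h1, h2, h3⟩ := h.exists_edgeSum_of_le hM hA
  refine ⟨s(q, v) ::ₘ N, by simp [h1], ?_, ?_⟩
  · intro e he
    rcases Multiset.mem_cons.1 he with rfl | he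
    exacts [hadj, h2 e he]
  · rw [edgeSum_cons, edgeVec_mk, ← add_assoc, ← h3]
    abel

lemma le_of_le_add_single {a w : V →₀ ℕ} {q : V} (h : a ≤ w + Finsupp.single q 1)
    (hq : a q = 0) : a ≤ w := by
  classical
  intro b
  by_cases hb : q = b
  · subst hb
    omega
  · simpa [Finsupp.single_apply, hb] using h b

/-- If a product of at least `|M|` edges divides `w` times the product of the edges in `M`,
then either there is an augmenting walk whose ends divide `w`, or the quotient is obtained by
exchanging along even alternating walks that start in `w`. -/
lemma exists_altAdj_or_exchange (hM : ∀ e ∈ M, e ∈ G.edgeSet) {N : Multiset (Sym2 V)}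
    (hN : ∀ e ∈ N, e ∈ G.edgeSet) {w : V →₀ ℕ} (hcard : M.card ≤ N.card)
    (hle : edgeSum N ≤ edgeSum M + w) :
    (∃ u v, AltAdj G M u v ∧ Finsupp.single u 1 + Finsupp.single v 1 ≤ w) ∨
      N.card = M.card ∧ ∃ P : Multiset (V × V), (P.map fun x => Finsupp.single x.1 1).sum ≤ w ∧
        edgeSum N + (P.map fun x => Finsupp.single x.2 1).sum =
          edgeSum M + (P.map fun x => Finsupp.single x.1 1).sum ∧
        ∀ x ∈ P, ∃ A ≤ M, EvenPath G A x.1 x.2 := by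
  classical
  induction M using Multiset.strongInductionOn generalizing N w with
  | ih M ih =>
  by_cases h0 : edgeSum N ≤ edgeSum M
  · obtain ⟨d, hd⟩ := exists_add_of_le h0
    have h1 := congrArg Finsupp.degree hd
    rw [map_add, degree_edgeSum, degree_edgeSum] at h1
    have h2 : d = 0 := (Finsupp.degree_eq_zero_iff d).1 (by omega)
    refine .inr ⟨by omega, 0, by simp, by simp [hd, h2], by simp⟩
  obtain ⟨u, hu⟩ : ∃ u, edgeSum M u < edgeSum N u := by
    rw [Finsupp.le_def] at h0
    push Not at h0
    exact h0
  obtain ⟨p, N, rfl⟩ := exists_mem_of_edgeSum_pos (pos_of_gt hu)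
  have hup : G.Adj u p := hN _ (Multiset.mem_cons_self _ _)
  have hwu : 1 ≤ w u := by
    have := hle u
    rw [Finsupp.add_apply] at this
    omega
  obtain ⟨w, rfl⟩ := exists_add_of_le (Finsupp.single_le_iff.2 hwu)
  rw [edgeSum_cons, edgeVec_mk] at hle
  by_cases hwp : 1 ≤ w p
  · exact .inl ⟨u, p, ⟨0, Multiset.zero_le _, .of_adj hup⟩,
      add_le_add_right (Finsupp.single_le_iff.2 hwp) _⟩
  have hMp : 0 < edgeSum M p := by
    have := hle p
    simp [hup.ne] at this
    omega
  obtain ⟨q, M, rfl⟩ := exists_mem_of_edgeSum_pos hMp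
  have hle' : edgeSum N ≤ edgeSum M + (w + Finsupp.single q 1) := by
    rw [edgeSum_cons, edgeVec_mk] at hle
    intro a
    have := hle a
    simp only [Finsupp.add_apply] at this ⊢
    omega
  simp only [Multiset.card_cons, add_le_add_iff_right] at hcard
  rcases ih M (Multiset.lt_cons_self _ _) (fun e he => hM e (Multiset.mem_cons_of_mem he))
    (fun e he => hN e (Multiset.mem_cons_of_mem he)) hcard hle' with
    ⟨a, b, hab, hle2⟩ | ⟨hcard', P, hP1, hP2, hP3⟩
  · left
    have key : ∀ a b, AltAdj G M a b →
        Finsupp.single a 1 + Finsupp.single b 1 ≤ w + Finsupp.single q 1 → a = q →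
        ∃ u' v', AltAdj G (s(p, q) ::ₘ M) u' v' ∧
          Finsupp.single u' 1 + Finsupp.single v' 1 ≤ Finsupp.single u 1 + w := by
      rintro a b ⟨A, hA, hab⟩ h rfl
      refine ⟨u, b, ⟨s(p, a) ::ₘ A, Multiset.cons_le_cons _ hA, .cons hup hab⟩, ?_⟩
      rw [add_comm, add_le_add_iff_right] at h
      exact add_le_add_right h _
    by_cases ha : a = q
    · exact key a b hab hle2 ha
    by_cases hb : b = q
    · exact key b a hab.symm (by rwa [add_comm]) hb
    obtain ⟨A, hA, hab⟩ := hab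
    refine ⟨a, b, ⟨A, hA.trans (Multiset.le_cons_self _ _), hab⟩, le_add_left ?_⟩
    exact le_of_le_add_single hle2 (by simp [ha, hb])
  · refine .inr ⟨by simp [hcard'], ?_⟩
    have hP3' : ∀ x ∈ P, ∃ A ≤ s(p, q) ::ₘ M, EvenPath G A x.1 x.2 := fun x hx =>
      let ⟨A, h1, h2⟩ := hP3 x hx
      ⟨A, h1.trans (Multiset.le_cons_self _ _), h2⟩
    by_cases hq : ∃ y, (q, y) ∈ P
    · obtain ⟨y, hy⟩ := hq
      obtain ⟨A, hA, hqy⟩ := hP3 _ hy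
      obtain ⟨P, rfl⟩ := Multiset.exists_cons_of_mem hy
      refine ⟨(u, y) ::ₘ P, ?_, ?_, ?_⟩
      · simp only [Multiset.map_cons, Multiset.sum_cons] at hP1 ⊢
        rw [add_comm, add_le_add_iff_right] at hP1
        exact add_le_add_right hP1 _
      · simp only [Multiset.map_cons, Multiset.sum_cons, edgeSum_cons, edgeVec_mk] at hP2 ⊢
        rw [add_assoc _ (edgeSum N), hP2]
        abel
      · intro x hx
        rcases Multiset.mem_cons.1 hx with rfl | hx
        · exact ⟨s(p, q) ::ₘ A, Multiset.cons_le_cons _ hA, .cons hup hqy⟩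
        · exact hP3' x (Multiset.mem_cons_of_mem hx)
    · refine ⟨(u, q) ::ₘ P, ?_, ?_, ?_⟩
      · simp only [Multiset.map_cons, Multiset.sum_cons]
        refine add_le_add_right (le_of_le_add_single hP1 ?_) _
        rw [← Finsupp.applyAddHom_apply, map_multiset_sum, Multiset.map_map]
        refine Multiset.sum_eq_zero fun n hn => ?_
        obtain ⟨x, hx, rfl⟩ := Multiset.mem_map.1 hn
        have : x.1 ≠ q := fun h => hq ⟨x.2, h ▸ hx⟩
        simp [this]
      · simp only [Multiset.map_cons, Multiset.sum_cons, edgeSum_cons, edgeVec_mk]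
        rw [add_left_comm, add_assoc _ (edgeSum N), hP2]
        abel
      · intro x hx
        rcases Multiset.mem_cons.1 hx with rfl | hx
        · exact ⟨{s(p, q)}, by simp, .single hup⟩
        · exact hP3' x hx

end Exchange

section PowerBound

variable {K : Type} [Field K] {V : Type}

/-- Exponent vectors of the products of `t` edges of `G`. -/
def edgeProds (G : SimpleGraph V) (t : ℕ) : Set (V →₀ ℕ) :=
  {m | ∃ N : Multiset (Sym2 V), N.card = t ∧ (∀ e ∈ N, e ∈ G.edgeSet) ∧ edgeSum N = m}

/-- Exponent vectors of the monomials divisible by one with exponent vector in `E`. -/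
def multiples (E : Set (V →₀ ℕ)) : Set (V →₀ ℕ) := {w | ∃ m ∈ E, m ≤ w}

lemma isUpperSet_multiples (E : Set (V →₀ ℕ)) : IsUpperSet (multiples E) :=
  fun _ _ hab ⟨m, h1, h2⟩ => ⟨m, h1, h2.trans hab⟩

lemma monIdeal_multiples (E : Set (V →₀ ℕ)) : monIdeal K (multiples E) = monIdeal K E := by
  ext p
  rw [mem_monIdeal (isUpperSet_multiples E), monIdeal, MvPolynomial.mem_ideal_span_monomial_image]
  rfl

variable {G : SimpleGraph V}

lemma edgeIdeal_pow_eq (s : ℕ) : edgeIdeal K G ^ s = monIdeal K (edgeProds G s) := by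
  induction s with
  | zero =>
    have : edgeProds G 0 = {0} := by
      ext m
      constructor
      · rintro ⟨N, h1, -, rfl⟩
        rw [Multiset.card_eq_zero.1 h1]
        rfl
      · rintro rfl
        exact ⟨0, rfl, by simp, rfl⟩
    rw [this, monIdeal, Set.image_singleton, pow_zero]
    rw [Ideal.one_eq_top]
    exact (Ideal.span_singleton_one (α := MvPolynomial V K)).symm
  | succ s ih =>
    rw [pow_succ, ih, monIdeal, edgeIdeal, Ideal.span_mul_span', monIdeal]
    congr 1
    have hX : ∀ u v : V, (MvPolynomial.X u * MvPolynomial.X v : MvPolynomial V K) =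
        MvPolynomial.monomial (edgeVec s(u, v)) 1 := fun u v => by
      rw [MvPolynomial.X, MvPolynomial.X, MvPolynomial.monomial_mul, one_mul, edgeVec_mk]
    ext p
    rw [Set.mem_mul]
    constructor
    · rintro ⟨_, ⟨_, ⟨N, h1, h2, rfl⟩, rfl⟩, _, ⟨u, v, huv, rfl⟩, rfl⟩
      refine ⟨_, ⟨s(u, v) ::ₘ N, by simp [h1], ?_, rfl⟩, ?_⟩
      · intro e he
        rcases Multiset.mem_cons.1 he with rfl | he
        exacts [huv, h2 e he]
      · simp only [hX, MvPolynomial.monomial_mul, one_mul, edgeSum_cons]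
        rw [add_comm]
    · rintro ⟨_, ⟨N, h1, h2, rfl⟩, rfl⟩
      obtain ⟨e, he⟩ := Multiset.card_pos_iff_exists_mem.1 (by omega : 0 < N.card)
      obtain ⟨N, rfl⟩ := Multiset.exists_cons_of_mem he
      obtain ⟨u, v⟩ := e
      refine ⟨_, ⟨_, ⟨N, by simpa using h1, fun e he => h2 e (Multiset.mem_cons_of_mem he), rfl⟩,
        rfl⟩, _, ⟨u, v, h2 _ (Multiset.mem_cons_self _ _), rfl⟩, ?_⟩
      simp only [hX, MvPolynomial.monomial_mul, one_mul]
      rw [add_comm]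
      exact congrArg (fun m => MvPolynomial.monomial m (1 : K)) (edgeSum_cons _ _).symm

lemma multiples_edgeProds_succ_subset (t : ℕ) :
    multiples (edgeProds G (t + 1)) ⊆ multiples (edgeProds G t) := by
  rintro w ⟨_, ⟨N, h1, h2, rfl⟩, h3⟩
  obtain ⟨e, he⟩ := Multiset.card_pos_iff_exists_mem.1 (by omega : 0 < N.card)
  obtain ⟨N, rfl⟩ := Multiset.exists_cons_of_mem he
  refine ⟨_, ⟨N, by simpa using h1, fun e he => h2 e (Multiset.mem_cons_of_mem he), rfl⟩, ?_⟩
  rw [edgeSum_cons] at h3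
  exact le_add_self.trans h3

lemma finite_edgeProds [Finite V] (t : ℕ) : (edgeProds G t).Finite := by
  classical
  refine (Set.finite_Iic (Finsupp.equivFunOnFinite.symm fun _ : V => 2 * t)).subset ?_
  rintro _ ⟨N, rfl, -, rfl⟩ v
  rw [← degree_edgeSum]
  exact Finsupp.le_degree v _

/-- Weight of an exponent vector. -/
noncomputable def weight (c : V → ℕ) : (V →₀ ℕ) →+ ℕ :=
  Finsupp.liftAddHom fun v => AddMonoidHom.mulRight (c v)

lemma weight_single (c : V → ℕ) (v : V) : weight c (Finsupp.single v 1) = c v := by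
  simp [weight]

/-- The colon ideals in the filtration from `I(G)^(t+1)` to `I(G)^t` are generated by variables
and by the products of the ends of alternating walks. -/
lemma colon_edgeProds {c : V → ℕ} (hc : Function.Injective c) {M : Multiset (Sym2 V)}
    (hM : ∀ e ∈ M, e ∈ G.edgeSet) {F : Set (V →₀ ℕ)} (hF : F ⊆ edgeProds G M.card)
    (hMF : edgeSum M ∉ F) (hle : ∀ m ∈ F, weight c (edgeSum M) ≤ weight c m)
    (hgt : ∀ m ∈ edgeProds G M.card, weight c (edgeSum M) < weight c m → m ∈ F) :
    {w | w + edgeSum M ∈ multiples (edgeProds G (M.card + 1)) ∪ multiples F} =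
      quadSet (AltAdj G M) {z | edgeSum M + Finsupp.single z 1 ∈ multiples F} := by
  ext w
  constructor
  · rintro (⟨_, ⟨N, h1, h2, rfl⟩, h3⟩ | ⟨m, hm, h3⟩)
    · rw [add_comm] at h3
      rcases exists_altAdj_or_exchange hM h2 (by omega) h3 with h | h
      · exact .inl h
      · omega
    · obtain ⟨N, h1, h2, rfl⟩ := hF hm
      rw [add_comm] at h3
      rcases exists_altAdj_or_exchange hM h2 h1.ge h3 with h | ⟨-, P, hP1, hP2, hP3⟩
      · exact .inl h
      obtain ⟨x, hx, hlt⟩ : ∃ x ∈ P, c x.2 < c x.1 := by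
        by_contra! hcon
        have h4 := congrArg (weight c) hP2
        rw [map_add, map_add, map_multiset_sum, map_multiset_sum, Multiset.map_map,
          Multiset.map_map] at h4
        simp only [Function.comp_def, weight_single] at h4
        have h5 := hle _ hm
        have h6 : ∀ x ∈ P, x.1 = x.2 := by
          by_contra! hne
          obtain ⟨x, hx, hne⟩ := hne
          have := Multiset.sum_lt_sum (f := fun x : V × V => c x.1) (g := fun x => c x.2) hcon
            ⟨x, hx, lt_of_le_of_ne (hcon x hx) (fun h => hne (hc h))⟩
          omega
        have h7 : (P.map fun x => (Finsupp.single x.1 1 : V →₀ ℕ)) =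
            P.map fun x => Finsupp.single x.2 1 :=
          Multiset.map_congr rfl fun x hx => by rw [h6 x hx]
        rw [h7, add_left_inj] at hP2
        exact hMF (hP2 ▸ hm)
      obtain ⟨A, hA, hpath⟩ := hP3 x hx
      obtain ⟨N', h4, h5, h6⟩ := hpath.exists_edgeSum_of_le hM hA
      refine .inr ⟨x.1, ⟨edgeSum N', hgt _ ⟨N', h4, h5, rfl⟩ ?_, ?_⟩, ?_⟩
      · have := congrArg (weight c) h6
        rw [map_add, map_add, weight_single, weight_single] at this
        omega
      · rw [← h6]
        exact le_self_add
      · refine Finsupp.single_le_iff.1 (le_trans ?_ hP1)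
        exact Multiset.single_le_sum (fun _ _ => zero_le) _ (Multiset.mem_map_of_mem _ hx)
  · rintro (⟨u, v, h1, h2⟩ | ⟨z, ⟨m, hm, h1⟩, h2⟩)
    · obtain ⟨N, h3, h4, h5⟩ := h1.exists_edgeSum hM
      refine .inl ⟨_, ⟨N, h3, h4, rfl⟩, ?_⟩
      rw [h5, add_comm w]
      exact add_le_add_right h2 _
    · refine .inr ⟨m, hm, h1.trans ?_⟩
      rw [add_comm w]
      exact add_le_add_right (Finsupp.single_le_iff.2 h2) _

variable [Finite V]

lemma RegIdealLE.edgeProds_succ_of {E₀ : Set (Sym2 V)} (hE₀ : E₀ ⊆ G.edgeSet)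
    (hcov : ∀ u v, G.Adj u v → ∃ e ∈ E₀, u ∈ e ∨ v ∈ e) (t : ℕ)
    (h0 : RegIdealLE (monIdeal K (multiples (edgeProds G t))) (E₀.ncard + 1 + 2 * t)) :
    RegIdealLE (monIdeal K (multiples (edgeProds G (t + 1)))) (E₀.ncard + 1 + 2 * t) := by
  classical
  obtain ⟨c, hc⟩ := exists_injective_nat V
  suffices h : ∀ T : Finset (V →₀ ℕ), ↑T ⊆ edgeProds G t →
      (∀ m ∈ T, ∀ m' ∈ edgeProds G t \ T, weight c m ≤ weight c m') →
      RegIdealLE (monIdeal K (multiples (edgeProds G (t + 1)) ∪ multiples (edgeProds G t \ T)))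
        (E₀.ncard + 1 + 2 * t) by
    have := h (finite_edgeProds (G := G) t).toFinset (by simp) (by simp)
    simpa [multiples] using this
  intro T
  induction T using Finset.induction_on_max_value (weight c) with
  | empty =>
    intro _ _
    rw [Finset.coe_empty, Set.sdiff_empty,
      Set.union_eq_self_of_subset_left (multiples_edgeProds_succ_subset t)]
    exact h0
  | insert a T ha hmax ih =>
    intro hT hw
    obtain ⟨M, rfl, hM, rfl⟩ := hT (Finset.mem_insert_self a T)
    have h1 := ih (fun m hm => hT (Finset.mem_insert_of_mem hm)) ?_
    · have hF : edgeProds G M.card \ T =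
          edgeProds G M.card \ ↑(insert (edgeSum M) T) ∪ {edgeSum M} := by
        ext m
        by_cases hm : m = edgeSum M
        · subst hm
          simp only [Set.mem_union, Set.mem_singleton_iff, or_true, iff_true]
          exact ⟨⟨M, rfl, hM, rfl⟩, ha⟩
        · simp [hm]
      have hsplit : multiples (edgeProds G (M.card + 1)) ∪ multiples (edgeProds G M.card \ T) =
          (multiples (edgeProds G (M.card + 1)) ∪
            multiples (edgeProds G M.card \ ↑(insert (edgeSum M) T))) ∪ {w | edgeSum M ≤ w} := by
        rw [Set.union_assoc, hF]
        congr 1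
        ext w
        constructor
        · rintro ⟨m, h2 | rfl, h3⟩
          exacts [.inl ⟨m, h2, h3⟩, .inr h3]
        · rintro (⟨m, h2, h3⟩ | h3)
          exacts [⟨m, .inl h2, h3⟩, ⟨_, .inr rfl, h3⟩]
      rw [hsplit, ← degree_edgeSum] at h1
      rw [← degree_edgeSum]
      refine RegIdealLE.of_colon ((isUpperSet_multiples _).union (isUpperSet_multiples _)) _ ?_ h1
      rw [colon_edgeProds hc hM Set.sdiff_subset (by simp)
        (hw _ (Finset.mem_insert_self _ _))]
      · exact RegIdealLE.quadSet_altAdj hM hE₀ hcov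
          (Set.ncard_le_ncard (Set.sep_subset _ _) (Set.toFinite _))
      · rintro m hm hlt
        refine ⟨hm, fun h => ?_⟩
        rcases Finset.mem_insert.1 h with rfl | h
        · exact hlt.false
        · exact absurd (hmax m h) (not_le.2 hlt)
    · rintro m hm m' ⟨h2, h3⟩
      by_cases h4 : m' = edgeSum M
      · exact h4 ▸ hmax m hm
      · exact hw m (Finset.mem_insert_of_mem hm) m' ⟨h2, by simpa [h4] using h3⟩

/-- If every edge of `G` meets one of `k` edges of `G`, then
`reg I(G)^(t+1) ≤ 2(t+1) + k - 1`. -/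
lemma RegIdealLE.edgeProds_succ {E₀ : Set (Sym2 V)} (hE₀ : E₀ ⊆ G.edgeSet)
    (hcov : ∀ u v, G.Adj u v → ∃ e ∈ E₀, u ∈ e ∨ v ∈ e) (t : ℕ) :
    RegIdealLE (monIdeal K (multiples (edgeProds G (t + 1)))) (E₀.ncard + 1 + 2 * t) := by
  induction t with
  | zero =>
    refine edgeProds_succ_of hE₀ hcov 0 ?_
    have : multiples (edgeProds G 0) = Set.univ :=
      Set.eq_univ_of_forall fun w => ⟨0, ⟨0, rfl, by simp, rfl⟩, zero_le⟩
    rw [this]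
    exact RegIdealLE.univ.mono (Nat.zero_le _)
  | succ t ih => exact edgeProds_succ_of hE₀ hcov (t + 1) (ih.mono (by omega))

lemma exists_isMaximalMatching (G : SimpleGraph V) : ∃ M : G.Subgraph, IsMaximalMatching G M := by
  have hfin : {M : G.Subgraph | M.IsMatching}.Finite := Set.toFinite _
  obtain ⟨M, hM⟩ := hfin.exists_maximal ⟨⊥, fun v hv => hv.elim⟩
  refine ⟨M, hM.prop, fun u v huv => ?_⟩
  by_contra! h
  have h1 : (G.subgraphOfAdj huv).IsMatching := Subgraph.IsMatching.subgraphOfAdj huv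
  have h2 : (M ⊔ G.subgraphOfAdj huv).IsMatching := by
    refine hM.prop.sup h1 ?_
    rw [Set.disjoint_right]
    rw [SimpleGraph.support_subgraphOfAdj]
    rintro x (rfl | rfl)
    exacts [h.1, h.2]
  have h3 := hM.le_of_ge h2 le_sup_left
  exact h.1 ⟨v, h3.2 (Or.inr rfl)⟩

end PowerBound

/-- For every finite simple graph `G` and every `s ≥ 1`,
`reg(I(G)^s) ≤ 2s + min-match(G) - 1`. -/
theorem stmt9 (K : Type) [Field K] {V : Type} [Fintype V] (G : SimpleGraph V)
    (s : ℕ) (hs : 1 ≤ s) :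
    reg K ((edgeIdeal K G) ^ s) ≤ 2 * s + minMatch G - 1 := by
  obtain ⟨M, hM, hcard⟩ : minMatch G ∈ {k | ∃ M : G.Subgraph, IsMaximalMatching G M ∧
      M.edgeSet.ncard = k} :=
    Nat.sInf_mem ((exists_isMaximalMatching G).elim fun M hM => ⟨_, M, hM, rfl⟩)
  obtain ⟨t, rfl⟩ : ∃ t, s = t + 1 := ⟨s - 1, by omega⟩
  have hcov : ∀ u v, G.Adj u v → ∃ e ∈ M.edgeSet, u ∈ e ∨ v ∈ e := by
    intro u v huv
    rcases hM.2 huv with ⟨w, hw⟩ | ⟨w, hw⟩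
    · exact ⟨s(u, w), hw, .inl (Sym2.mem_mk_left _ _)⟩
    · exact ⟨s(v, w), hw, .inr (Sym2.mem_mk_left _ _)⟩
  refine Nat.sInf_le (RegIdealLE.hasResolutionDegreeBound ?_)
  rw [edgeIdeal_pow_eq, ← monIdeal_multiples]
  exact (RegIdealLE.edgeProds_succ M.edgeSet_subset hcov t).mono (by omega)

end Paper
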